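/- arXiv:1310.1896 — 4 statements merged into one kernel-verified Lean document; each statement's English description precedes it below -/
import Mathlib

section
/- Let G = (V,E) be a cubic simple graph and let H_1 = (W_1, m_1) and H_2 = (W_2, m_2) be two connected Eulerian multi-subgraphs of G such that |W_1 ∩ W_2| ≥ 2. Then there exists a multiplicity function m_3 : E → ℕ with m_3(e) ≤ m_1(e) + m_2(e) for every edge e and Σ_{e∈E} m_3(e) = Σ_{e∈E} (m_1(e) + m_2(e)) − 2, such that (W_1 ∪ W_2, m_3) is again a connected Eulerian multi-subgraph of G. -/
open SimpleGraph

/-- `(W, m)` is a multi-subgraph of `G`: every edge with positive multiplicity is an edge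
of `G` with both endpoints in `W`. -/
def IsMultiSubgraph {V : Type*} (G : SimpleGraph V) (W : Set V) (m : Sym2 V → ℕ) : Prop :=
  ∀ e : Sym2 V, 0 < m e → e ∈ G.edgeSet ∧ ∀ v ∈ e, v ∈ W

/-- The degree of a vertex `v` in the multi-subgraph `(W, m)`. -/
noncomputable def multiDegree {V : Type*} [Fintype V] [DecidableEq V]
    (G : SimpleGraph V) [DecidableRel G.Adj] (m : Sym2 V → ℕ) (v : V) : ℕ :=
  ∑ e ∈ G.incidenceFinset v, m e

/-- `(W, m)` is a connected Eulerian multi-subgraph of `G`: it is a multi-subgraph, every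
vertex of `W` has positive even degree, and the underlying multigraph on `W` is connected. -/
noncomputable def IsConnectedEulerianMultiSubgraph {V : Type*} [Fintype V] [DecidableEq V]
    (G : SimpleGraph V) [DecidableRel G.Adj] (W : Set V) (m : Sym2 V → ℕ) : Prop :=
  IsMultiSubgraph G W m ∧
  (∀ v ∈ W, 0 < multiDegree G m v ∧ Even (multiDegree G m v)) ∧
  ((SimpleGraph.fromEdgeSet {e : Sym2 V | 0 < m e}).induce W).Connected

/-- The support graph of a multiplicity function. -/
def suppG {V : Type*} (m : Sym2 V → ℕ) : SimpleGraph V :=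
  SimpleGraph.fromEdgeSet {e : Sym2 V | 0 < m e}

theorem suppG_adj {V : Type*} (m : Sym2 V → ℕ) (x y : V) :
    (suppG m).Adj x y ↔ 0 < m s(x, y) ∧ x ≠ y := by
  simp [suppG]

theorem reach_of_adj {V : Type*} {A B : SimpleGraph V}
    (h : ∀ x y, A.Adj x y → B.Reachable x y) {x y : V} (hr : A.Reachable x y) :
    B.Reachable x y := by
  obtain ⟨p⟩ := hr
  induction p with
  | nil => exact Reachable.refl _
  | cons hadj p ih => exact (h _ _ hadj).trans ih

theorem reach_of_conn {V : Type*} {A : SimpleGraph V} {W : Set V}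
    (h : (A.induce W).Connected) {x y : V} (hx : x ∈ W) (hy : y ∈ W) : A.Reachable x y := by
  have := h.preconnected ⟨x, hx⟩ ⟨y, hy⟩
  exact this.map (SimpleGraph.Embedding.induce W).toHom

theorem conn_of_reach {V : Type*} {A : SimpleGraph V} {W : Set V} {u : V} (hu : u ∈ W)
    (hA : ∀ x y, A.Adj x y → y ∈ W) (h : ∀ x ∈ W, A.Reachable x u) :
    (A.induce W).Connected := by
  have key : ∀ x y (hy : y ∈ W) (hx : x ∈ W), A.Walk x y →
      (A.induce W).Reachable ⟨x, hx⟩ ⟨y, hy⟩ := by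
    intro x y hy hx p
    induction p with
    | nil => exact Reachable.refl _
    | cons hadj p ih =>
      have hv := hA _ _ hadj
      refine Reachable.trans (Adj.reachable ?_) (ih hy hv)
      simpa using hadj
  haveI : Nonempty W := ⟨⟨u, hu⟩⟩
  refine ⟨?_⟩
  rintro ⟨x, hx⟩ ⟨y, hy⟩
  obtain ⟨p⟩ := h x hx
  obtain ⟨q⟩ := h y hy
  exact (key x u hu hx p).trans (key y u hu hy q).symm

/-- The multiplicity function with two copies of `e` removed. -/
noncomputable def dropTwo {V : Type*} [DecidableEq V] (m₁ m₂ : Sym2 V → ℕ) (e : Sym2 V) :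
    Sym2 V → ℕ :=
  fun f => m₁ f + m₂ f - if f = e then 2 else 0

theorem multiDegree_outside {V : Type*} [Fintype V] [DecidableEq V]
    (G : SimpleGraph V) [DecidableRel G.Adj] {W : Set V} {m : Sym2 V → ℕ}
    (h : IsMultiSubgraph G W m) {v : V} (hv : v ∉ W) : multiDegree G m v = 0 := by
  unfold multiDegree
  refine Finset.sum_eq_zero fun e he => ?_
  by_contra hne
  refine hv ((h e (Nat.pos_of_ne_zero hne)).2 v ?_)
  rw [SimpleGraph.mem_incidenceFinset] at he
  exact he.2

theorem even_deg {V : Type*} [Fintype V] [DecidableEq V]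
    (G : SimpleGraph V) [DecidableRel G.Adj] {W : Set V} {m : Sym2 V → ℕ}
    (h : IsConnectedEulerianMultiSubgraph G W m) (v : V) : Even (multiDegree G m v) := by
  by_cases hv : v ∈ W
  · exact (h.2.1 v hv).2
  · rw [multiDegree_outside G h.1 hv]; exact Even.zero

theorem sum_drop {V : Type*} [DecidableEq V] (m₁ m₂ : Sym2 V → ℕ) (e : Sym2 V)
    (he : 2 ≤ m₁ e + m₂ e) (S : Finset (Sym2 V)) :
    ∑ f ∈ S, dropTwo m₁ m₂ e f + (if e ∈ S then 2 else 0) = ∑ f ∈ S, (m₁ f + m₂ f) := by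
  rw [← Finset.sum_ite_eq' S e (fun _ => 2), ← Finset.sum_add_distrib]
  refine Finset.sum_congr rfl fun f _ => ?_
  unfold dropTwo
  split_ifs with h
  · subst h; omega
  · omega

theorem finish {V : Type*} [Fintype V] [DecidableEq V]
    (G : SimpleGraph V) [DecidableRel G.Adj]
    (W₁ W₂ : Set V) (m₁ m₂ : Sym2 V → ℕ)
    (h₁ : IsConnectedEulerianMultiSubgraph G W₁ m₁)
    (h₂ : IsConnectedEulerianMultiSubgraph G W₂ m₂)
    (u v : V) (huv : u ≠ v) (hu : u ∈ W₁ ∪ W₂) (hv : v ∈ W₁ ∪ W₂)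
    (e : Sym2 V) (he : 2 ≤ m₁ e + m₂ e)
    (hR : ∀ x ∈ W₁ ∪ W₂, (suppG (dropTwo m₁ m₂ e)).Reachable x u) :
    ∃ m₃ : Sym2 V → ℕ,
      (∀ e, m₃ e ≤ m₁ e + m₂ e) ∧
      (∑ e ∈ G.edgeFinset, m₃ e) + 2 = ∑ e ∈ G.edgeFinset, (m₁ e + m₂ e) ∧
      IsConnectedEulerianMultiSubgraph G (W₁ ∪ W₂) m₃ := by
  have hle : ∀ f, dropTwo m₁ m₂ e f ≤ m₁ f + m₂ f := fun f => Nat.sub_le _ _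
  have hsub : ∀ f, 0 < m₁ f + m₂ f → f ∈ G.edgeSet ∧ ∀ w ∈ f, w ∈ W₁ ∪ W₂ := by
    intro f hf
    rcases Nat.eq_zero_or_pos (m₁ f) with h | h
    · have := h₂.1 f (by omega)
      exact ⟨this.1, fun w hw => Or.inr (this.2 w hw)⟩
    · have := h₁.1 f h
      exact ⟨this.1, fun w hw => Or.inl (this.2 w hw)⟩
  have hms : IsMultiSubgraph G (W₁ ∪ W₂) (dropTwo m₁ m₂ e) := fun f hf =>
    hsub f (lt_of_lt_of_le hf (hle f))
  refine ⟨dropTwo m₁ m₂ e, hle, ?_, hms, ?_, ?_⟩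
  · have := sum_drop m₁ m₂ e he G.edgeFinset
    rw [if_pos (SimpleGraph.mem_edgeFinset.2 (hsub e (by omega)).1)] at this
    exact this
  · intro w hw
    constructor
    · have : ∃ z, z ≠ w ∧ (suppG (dropTwo m₁ m₂ e)).Reachable w z := by
        by_cases hwu : w = u
        · subst hwu; exact ⟨v, huv.symm, (hR v hv).symm⟩
        · exact ⟨u, Ne.symm hwu, hR w hw⟩
      obtain ⟨z, hz, ⟨p⟩⟩ := this
      cases p with
      | nil => exact absurd rfl hz
      | @cons _ y _ hadj p =>
        rw [suppG_adj] at hadj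
        have hmem : s(w, y) ∈ G.incidenceFinset w := by
          rw [SimpleGraph.mem_incidenceFinset]
          exact ⟨(hms _ hadj.1).1, by simp⟩
        exact lt_of_lt_of_le hadj.1
          (Finset.single_le_sum (f := dropTwo m₁ m₂ e) (fun _ _ => Nat.zero_le _) hmem)
    · have := sum_drop m₁ m₂ e he (G.incidenceFinset w)
      rw [Finset.sum_add_distrib] at this
      have e1 := even_deg G h₁ w
      have e2 := even_deg G h₂ w
      unfold multiDegree at *
      rw [Nat.even_iff] at *
      split_ifs at this <;> omega
  · refine conn_of_reach hu ?_ hR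
    intro x y hxy
    have := (suppG_adj _ x y).1 hxy
    exact (hms _ this.1).2 y (by simp)

/-- An edge of odd multiplicity in an Eulerian multigraph is not a bridge. -/
theorem odd_not_bridge {V : Type*} [Fintype V] [DecidableEq V]
    (G : SimpleGraph V) [DecidableRel G.Adj] {W : Set V} {m : Sym2 V → ℕ}
    (h : IsConnectedEulerianMultiSubgraph G W m) (a b : V) (hodd : Odd (m s(a, b)))
    (B : SimpleGraph V)
    (hB : ∀ x y, x ≠ y → 0 < m s(x, y) → s(x, y) ≠ s(a, b) → B.Adj x y) :
    B.Reachable a b := by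
  classical
  by_contra hab
  let S : Finset V := Finset.univ.filter fun x => B.Reachable a x
  have haS : a ∈ S := by simp [S]
  have hbS : b ∉ S := by simpa [S] using hab
  have hpos : 0 < m s(a, b) := hodd.pos
  have hE : s(a, b) ∈ G.edgeFinset := SimpleGraph.mem_edgeFinset.2 (h.1 _ hpos).1
  have hsum : ∑ v ∈ S, multiDegree G m v =
      ∑ e ∈ G.edgeFinset, ∑ v ∈ S, if v ∈ e then m e else 0 := by
    rw [Finset.sum_comm]
    refine Finset.sum_congr rfl fun v _ => ?_
    unfold multiDegree
    rw [SimpleGraph.incidenceFinset_eq_filter, Finset.sum_filter]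
  have hev : Even (∑ v ∈ S, multiDegree G m v) :=
    Finset.even_sum _ fun v _ => even_deg G h v
  rw [hsum, ← Finset.add_sum_erase _ _ hE] at hev
  have h1 : (∑ v ∈ S, if v ∈ s(a, b) then m s(a, b) else 0) = m s(a, b) := by
    rw [Finset.sum_eq_single a]
    · simp
    · intro x hx hxa
      have : x ≠ b := fun hh => hbS (hh ▸ hx)
      simp [hxa, this]
    · intro hh; exact absurd haS hh
  have h2 : Even (∑ e ∈ G.edgeFinset.erase s(a, b), ∑ v ∈ S, if v ∈ e then m e else 0) := by
    refine Finset.even_sum _ fun f hf => ?_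
    rw [Finset.mem_erase, SimpleGraph.mem_edgeFinset] at hf
    obtain ⟨hne, hfG⟩ := hf
    induction f using Sym2.ind with
    | _ x y =>
    have hxy : x ≠ y := G.ne_of_adj hfG
    rcases Nat.eq_zero_or_pos (m s(x, y)) with h0 | h0
    · simp [h0]
    · have hadj := hB x y hxy h0 hne
      have hiff : x ∈ S ↔ y ∈ S := by
        simp only [S, Finset.mem_filter, Finset.mem_univ, true_and]
        exact ⟨fun hh => hh.trans hadj.reachable, fun hh => hh.trans hadj.symm.reachable⟩
      have hsplit : ∀ v, (if v ∈ s(x, y) then m s(x, y) else 0) =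
          (if v = x then m s(x, y) else 0) + (if v = y then m s(x, y) else 0) := by
        intro v
        by_cases hvx : v = x
        · subst hvx; simp [hxy]
        · simp [hvx]
      simp only [hsplit]
      rw [Finset.sum_add_distrib, Finset.sum_ite_eq', Finset.sum_ite_eq']
      by_cases hx : x ∈ S
      · simp [hx, hiff.1 hx]
      · have hy : y ∉ S := fun hh => hx (hiff.2 hh)
        simp [hx, hy]
  rw [h1] at hev
  rw [Nat.even_iff] at *
  rw [Nat.odd_iff] at hodd
  omega

/-- Removing a leaf edge keeps the other vertices connected. -/
theorem leaf_reach {V : Type*} {A B : SimpleGraph V} {v b : V}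
    (hleaf : ∀ x, A.Adj v x → x = b)
    (hB : ∀ x y, A.Adj x y → x ≠ v → y ≠ v → B.Adj x y)
    {x y : V} (hr : A.Reachable x y) (hy : y ≠ v) (hx : x ≠ v) : B.Reachable x y := by
  have key : ∀ x y, A.Walk x y → y ≠ v →
      (x ≠ v → B.Reachable x y) ∧ (x = v → B.Reachable b y) := by
    intro x y p hy
    induction p with
    | nil => exact ⟨fun _ => Reachable.refl _, fun hh => absurd hh hy⟩
    | @cons p q r hadj w ih =>
      have ih := ih hy
      refine ⟨fun hp => ?_, fun hp => ?_⟩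
      · by_cases hq : q = v
        · have : p = b := hleaf p (hq ▸ hadj.symm)
          rw [this]; exact ih.2 hq
        · exact (hB _ _ hadj hp hq).reachable.trans (ih.1 hq)
      · subst hp
        have hqb := hleaf q hadj
        have := ih.1 hadj.symm.ne
        rwa [hqb] at this
  obtain ⟨p⟩ := hr
  exact (key x y p hy).1 hx

theorem leaf_case {V : Type*} [Fintype V] [DecidableEq V]
    (G : SimpleGraph V) [DecidableRel G.Adj]
    (W₁ W₂ : Set V) (m₁ m₂ : Sym2 V → ℕ)
    (h₁ : IsConnectedEulerianMultiSubgraph G W₁ m₁)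
    (h₂ : IsConnectedEulerianMultiSubgraph G W₂ m₂)
    (u v : V) (huv : u ≠ v) (hu1 : u ∈ W₁) (hu2 : u ∈ W₂) (hv1 : v ∈ W₁) (hv2 : v ∈ W₂)
    (hdisj : ∀ e, 0 < m₁ e → m₂ e = 0)
    (hcard : ((G.incidenceFinset v).filter fun e => 0 < m₁ e).card ≤ 1) :
    ∃ m₃ : Sym2 V → ℕ,
      (∀ e, m₃ e ≤ m₁ e + m₂ e) ∧
      (∑ e ∈ G.edgeFinset, m₃ e) + 2 = ∑ e ∈ G.edgeFinset, (m₁ e + m₂ e) ∧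
      IsConnectedEulerianMultiSubgraph G (W₁ ∪ W₂) m₃ := by
  obtain ⟨hdpos, hdev⟩ := h₁.2.1 v hv1
  have hex : ∃ e ∈ G.incidenceFinset v, 0 < m₁ e := by
    by_contra! hno
    have : multiDegree G m₁ v = 0 :=
      Finset.sum_eq_zero fun e he => Nat.le_zero.1 (hno e he)
    omega
  obtain ⟨e, heI, hepos⟩ := hex
  have honly : ∀ f ∈ G.incidenceFinset v, 0 < m₁ f → f = e := by
    intro f hf hf0
    exact Finset.card_le_one.1 hcard f (Finset.mem_filter.2 ⟨hf, hf0⟩) e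
      (Finset.mem_filter.2 ⟨heI, hepos⟩)
  have hdeg : multiDegree G m₁ v = m₁ e := by
    unfold multiDegree
    refine Finset.sum_eq_single e (fun f hf hne => ?_) (fun hh => absurd heI hh)
    by_contra h0
    exact hne (honly f hf (Nat.pos_of_ne_zero h0))
  rw [hdeg] at hdev
  have hve : v ∈ e := ((SimpleGraph.mem_incidenceFinset _ _ _).1 heI).2
  obtain ⟨b, rfl⟩ := hve
  have hm2 := hdisj _ hepos
  have h2e : 2 ≤ m₁ s(v, b) := by
    obtain ⟨k, hk⟩ := hdev
    omega
  have hR2 : ∀ x ∈ W₂, (suppG (dropTwo m₁ m₂ s(v, b))).Reachable x u := by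
    intro x hx
    have hr : (suppG m₂).Reachable x u := reach_of_conn h₂.2.2 hx hu2
    refine reach_of_adj (fun p q hpq => ?_) hr
    rw [suppG_adj] at hpq
    refine Adj.reachable ((suppG_adj _ _ _).2 ⟨?_, hpq.2⟩)
    unfold dropTwo
    rw [if_neg]
    · omega
    · intro hh; rw [hh] at hpq; omega
  refine finish G W₁ W₂ m₁ m₂ h₁ h₂ u v huv (Or.inl hu1) (Or.inl hv1) s(v, b) (by omega) ?_
  rintro x (hx | hx)
  · by_cases hxv : x = v
    · subst hxv; exact hR2 x hv2
    · have hr : (suppG m₁).Reachable x u := reach_of_conn h₁.2.2 hx hu1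
      refine leaf_reach (b := b) ?_ ?_ hr huv hxv
      · intro y hy
        rw [suppG_adj] at hy
        have := honly s(v, y) ((SimpleGraph.mem_incidenceFinset _ _ _).2
          ⟨(h₁.1 _ hy.1).1, by simp⟩) hy.1
        exact Sym2.congr_right.1 this
      · intro p q hpq hp hq
        rw [suppG_adj] at hpq ⊢
        refine ⟨?_, hpq.2⟩
        unfold dropTwo
        rw [if_neg]
        · omega
        · intro hh
          have : v ∈ s(p, q) := by rw [hh]; simp
          rcases Sym2.mem_iff.1 this with h | h
          · exact hp h.symm
          · exact hq h.symm
  · exact hR2 x hx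

theorem odd_reach {V : Type*} [Fintype V] [DecidableEq V]
    (G : SimpleGraph V) [DecidableRel G.Adj] {W : Set V} {m m' : Sym2 V → ℕ}
    (h : IsConnectedEulerianMultiSubgraph G W m) (a b : V) (hodd : Odd (m s(a, b)))
    (hm : ∀ f, f ≠ s(a, b) → m f ≤ m' f) {x y : V} (hx : x ∈ W) (hy : y ∈ W) :
    (suppG m').Reachable x y := by
  have hB : ∀ x y, x ≠ y → 0 < m s(x, y) → s(x, y) ≠ s(a, b) → (suppG m').Adj x y := by
    intro x y hxy h0 hne
    exact (suppG_adj _ _ _).2 ⟨lt_of_lt_of_le h0 (hm _ hne), hxy⟩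
  have hab := odd_not_bridge G h a b hodd _ hB
  have hr : (suppG m).Reachable x y := reach_of_conn h.2.2 hx hy
  refine reach_of_adj (fun p q hpq => ?_) hr
  rw [suppG_adj] at hpq
  by_cases hpe : s(p, q) = s(a, b)
  · rcases Sym2.eq_iff.1 hpe with ⟨rfl, rfl⟩ | ⟨rfl, rfl⟩
    · exact hab
    · exact hab.symm
  · exact (hB p q hpq.2 hpq.1 hpe).reachable

/-- Merging two connected Eulerian multi-subgraphs sharing at least two vertices:
their sum minus two edges is again a connected Eulerian multi-subgraph. -/
theorem stmt4 {V : Type*} [Fintype V] [DecidableEq V]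
    (G : SimpleGraph V) [DecidableRel G.Adj]
    (hcubic : ∀ v : V, G.degree v = 3)
    (W₁ W₂ : Set V) (m₁ m₂ : Sym2 V → ℕ)
    (h₁ : IsConnectedEulerianMultiSubgraph G W₁ m₁)
    (h₂ : IsConnectedEulerianMultiSubgraph G W₂ m₂)
    (hmeet : 2 ≤ (W₁ ∩ W₂).ncard) :
    ∃ m₃ : Sym2 V → ℕ,
      (∀ e, m₃ e ≤ m₁ e + m₂ e) ∧
      (∑ e ∈ G.edgeFinset, m₃ e) + 2 = ∑ e ∈ G.edgeFinset, (m₁ e + m₂ e) ∧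
      IsConnectedEulerianMultiSubgraph G (W₁ ∪ W₂) m₃ := by
  obtain ⟨u, v, ⟨hu1, hu2⟩, ⟨hv1, hv2⟩, huv⟩ := (Set.one_lt_ncard_iff (Set.toFinite _)).1 hmeet
  by_cases hbig : ∃ e, 3 ≤ m₁ e + m₂ e
  · obtain ⟨e, he⟩ := hbig
    have hle : ∀ f, 0 < m₁ f + m₂ f → 0 < dropTwo m₁ m₂ e f := by
      intro f hf
      unfold dropTwo
      split_ifs with h
      · subst h; omega
      · omega
    refine finish G W₁ W₂ m₁ m₂ h₁ h₂ u v huv (Or.inl hu1) (Or.inl hv1) e (by omega) ?_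
    rintro x (hx | hx)
    · have hr : (suppG m₁).Reachable x u := reach_of_conn h₁.2.2 hx hu1
      refine reach_of_adj (fun p q hpq => ?_) hr
      rw [suppG_adj] at hpq
      exact Adj.reachable ((suppG_adj _ _ _).2 ⟨hle _ (by omega), hpq.2⟩)
    · have hr : (suppG m₂).Reachable x u := reach_of_conn h₂.2.2 hx hu2
      refine reach_of_adj (fun p q hpq => ?_) hr
      rw [suppG_adj] at hpq
      exact Adj.reachable ((suppG_adj _ _ _).2 ⟨hle _ (by omega), hpq.2⟩)
  push Not at hbig
  by_cases hone : ∃ e, m₁ e = 1 ∧ m₂ e = 1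
  · obtain ⟨e, he1, he2⟩ := hone
    refine finish G W₁ W₂ m₁ m₂ h₁ h₂ u v huv (Or.inl hu1) (Or.inl hv1) e (by omega) ?_
    induction e using Sym2.ind with
    | _ a b =>
    rintro x (hx | hx)
    · refine odd_reach G h₁ a b (by rw [he1]; exact odd_one) (fun f hf => ?_) hx hu1
      simp [dropTwo, hf]
    · refine odd_reach G h₂ a b (by rw [he2]; exact odd_one) (fun f hf => ?_) hx hu2
      simp [dropTwo, hf]
  push Not at hone
  have hdisj : ∀ e, 0 < m₁ e → m₂ e = 0 := by
    intro e he
    have := hbig e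
    have := hone e
    omega
  have hc3 : (G.incidenceFinset v).card = 3 := by
    rw [SimpleGraph.card_incidenceFinset_eq_degree, hcubic]
  have hcards : ((G.incidenceFinset v).filter fun e => 0 < m₁ e).card +
      ((G.incidenceFinset v).filter fun e => 0 < m₂ e).card ≤ 3 := by
    rw [← hc3, ← Finset.card_union_of_disjoint]
    · refine Finset.card_le_card (Finset.union_subset ?_ ?_) <;> exact Finset.filter_subset _ _
    · rw [Finset.disjoint_filter]
      intro e _ he
      have := hdisj e he
      omega
  by_cases hA : ((G.incidenceFinset v).filter fun e => 0 < m₁ e).card ≤ 1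
  · exact leaf_case G W₁ W₂ m₁ m₂ h₁ h₂ u v huv hu1 hu2 hv1 hv2 hdisj hA
  · obtain ⟨m₃, ha, hb, hc⟩ := leaf_case G W₂ W₁ m₂ m₁ h₂ h₁ u v huv hu2 hu1 hv2 hv1
      (fun e he => by
        by_contra h0
        have := hdisj e (Nat.pos_of_ne_zero h0)
        omega) (by omega)
    refine ⟨m₃, fun e => by rw [add_comm]; exact ha e, ?_, by rw [Set.union_comm]; exact hc⟩
    rw [hb]
    exact Finset.sum_congr rfl fun e _ => add_comm _ _
end

section
/- Let G = (V,E) be a simple graph and U ⊂ V a set with exactly two edges e_1, e_2 of G having exactly one endpoint in U; let v, w ∈ U be the (distinct) endpoints of e_1, e_2 inside U and p_1, p_2 their endpoints outside U. Suppose the induced subgraph G[U] has a Hamiltonian cycle and a Hamiltonian path from v to w. Let H be the graph with vertex set (V ∖ U) ∪ {d_1, d_2, d_3, d_4} (four new vertices) whose edges are: all edges of G with both endpoints in V ∖ U, the five edges d_1d_2, d_2d_3, d_3d_4, d_4d_1, d_1d_3 (a 4-cycle with a chord), and the edges p_1d_2 and p_2d_4. Then for every tour T' of H there exists a tour T of G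 of length at most |T'| + |U| − 4. -/
open SimpleGraph

/-- The graph `H` obtained from `G` by replacing the part `G[U]` by a chorded 4-cycle on four
new vertices `d₁, d₂, d₃, d₄` (indices `0,1,2,3`): edges of `G` with both endpoints outside `U`,
the 4-cycle `d₁d₂d₃d₄` with chord `d₁d₃`, and the edges `p₁d₂` and `p₂d₄`. -/
def replaceByChordedSquare {V : Type*} (G : SimpleGraph V) (U : Set V) (p₁ p₂ : V) :
    SimpleGraph ((↥(Uᶜ)) ⊕ Fin 4) :=
  SimpleGraph.fromRel (fun a b =>
    match a, b with
    | Sum.inl a, Sum.inl b => G.Adj (a : V) (b : V)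
    | Sum.inr i, Sum.inr j =>
        s(i, j) ∈ ({s(0, 1), s(1, 2), s(2, 3), s(3, 0), s(0, 2)} : Set (Sym2 (Fin 4)))
    | Sum.inl a, Sum.inr j => ((a : V) = p₁ ∧ j = 1) ∨ ((a : V) = p₂ ∧ j = 3)
    | Sum.inr _, Sum.inl _ => False)

namespace Stmt5Aux

/-- First exit of a walk from a set. -/
lemma first_exit {α : Type*} {H : SimpleGraph α} (S : α → Prop) {x y : α} (W : H.Walk x y)
    (hx : S x) :
    (∀ u ∈ W.support, S u) ∨
    ∃ (c d : α) (W₁ : H.Walk x c) (h : H.Adj c d) (W₂ : H.Walk d y),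
      W = W₁.append (Walk.cons h W₂) ∧ (∀ u ∈ W₁.support, S u) ∧ ¬ S d := by
  induction W with
  | nil => left; simpa using hx
  | @cons x z y h p ih =>
    by_cases hz : S z
    · rcases ih hz with h1 | ⟨c, d, W₁, h', W₂, rfl, h2, h3⟩
      · left
        intro u hu
        simp only [Walk.support_cons, List.mem_cons] at hu
        rcases hu with rfl | hu
        · exact hx
        · exact h1 u hu
      · right
        refine ⟨c, d, Walk.cons h W₁, h', W₂, by simp, ?_, h3⟩
        intro u hu
        simp only [Walk.support_cons, List.mem_cons] at hu
        rcases hu with rfl | hu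
        · exact hx
        · exact h2 u hu
    · right
      exact ⟨x, z, Walk.nil, h, p, by simp, by simpa using hx, hz⟩

lemma left_walk {V : Type*} {G : SimpleGraph V} {U : Set V} {H : SimpleGraph (↥(Uᶜ) ⊕ Fin 4)}
    (hLL : ∀ a b, H.Adj (Sum.inl a) (Sum.inl b) → (G.induce Uᶜ).Adj a b)
    {x y : ↥(Uᶜ) ⊕ Fin 4} (W : H.Walk x y) (hW : ∀ u ∈ W.support, u.isLeft = true)
    (a b : ↥(Uᶜ)) (hx : x = Sum.inl a) (hy : y = Sum.inl b) :
    ∃ q : (G.induce Uᶜ).Walk a b, W.support = q.support.map Sum.inl ∧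
      W.edges = q.edges.map (Sym2.map Sum.inl) := by
  induction W generalizing a with
  | nil =>
    subst hx
    cases hy
    exact ⟨Walk.nil, by simp, by simp⟩
  | @cons x z y h p ih =>
    subst hx hy
    have hz : z.isLeft = true := hW z (by simp)
    obtain ⟨c, rfl⟩ := Sum.isLeft_iff.1 hz
    obtain ⟨q, h1, h2⟩ := ih (fun u hu => hW u (by simp [hu])) c rfl rfl
    exact ⟨Walk.cons (hLL _ _ h) q, by simp [h1], by simp [h2]⟩

lemma excursion {V : Type*} {G : SimpleGraph V} {U : Set V} {H : SimpleGraph (↥(Uᶜ) ⊕ Fin 4)}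
    (P : Bool → ↥(Uᶜ)) (D : Bool → Fin 4)
    (hLL : ∀ a b, H.Adj (Sum.inl a) (Sum.inl b) → (G.induce Uᶜ).Adj a b)
    (hLR : ∀ a i, H.Adj (Sum.inl a) (Sum.inr i) → ∃ t, a = P t ∧ i = D t)
    {a b : ↥(Uᶜ)} (W : H.Walk (Sum.inl a) (Sum.inl b)) :
    (∃ q : (G.induce Uᶜ).Walk a b, W.support = q.support.map Sum.inl ∧
      W.edges = q.edges.map (Sym2.map Sum.inl)) ∨
    ∃ (t s : Bool) (q : (G.induce Uᶜ).Walk a (P t)) (E : H.Walk (Sum.inr (D t)) (Sum.inr (D s)))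
      (W' : H.Walk (Sum.inl (P s)) (Sum.inl b)),
      W.support = q.support.map Sum.inl ++ (E.support ++ W'.support) ∧
      W.edges = q.edges.map (Sym2.map Sum.inl) ++
        s(Sum.inl (P t), Sum.inr (D t)) :: (E.edges ++
        s(Sum.inl (P s), Sum.inr (D s)) :: W'.edges) ∧
      (∀ u ∈ E.support, u.isRight = true) := by
  rcases first_exit (fun u => u.isLeft = true) W rfl with h | ⟨c, d, W₁, h, W₂, rfl, h1, h2⟩
  · left; exact left_walk hLL W h a b rfl rfl
  · right
    have hc : c.isLeft = true := h1 c (by simp)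
    obtain ⟨c, rfl⟩ := Sum.isLeft_iff.1 hc
    rcases d with d | i
    · simp at h2
    obtain ⟨t, rfl, rfl⟩ := hLR _ _ h
    obtain ⟨q, hq1, hq2⟩ := left_walk hLL W₁ h1 _ _ rfl rfl
    rcases first_exit (fun u => u.isRight = true) W₂ rfl with h | ⟨c, d, W₃, h', W₄, rfl, h3, h4⟩
    · have := h (Sum.inl b) (by simp)
      simp at this
    have hc : c.isRight = true := h3 c (by simp)
    obtain ⟨c, rfl⟩ := Sum.isRight_iff.1 hc
    rcases d with d | i
    · obtain ⟨s, rfl, rfl⟩ := hLR _ _ h'.symm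
      refine ⟨t, s, q, W₃, W₄, ?_, ?_, h3⟩
      · simp [Walk.support_append, hq1]
      · simp [Walk.edges_append, hq2, Sym2.eq_swap]
    · simp at h4

lemma count_append_le {α : Type*} [DecidableEq α] {A B : List α} (hd : ∀ e ∈ A, e ∉ B)
    (hA : ∀ e, A.count e ≤ 2) (hB : ∀ e, B.count e ≤ 2) (e : α) : (A ++ B).count e ≤ 2 := by
  rw [List.count_append]
  by_cases h : e ∈ A
  · rw [List.count_eq_zero_of_not_mem (hd e h)]; simpa using hA e
  · rw [List.count_eq_zero_of_not_mem h]; simpa using hB e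

lemma count_map_le {α β : Type*} [DecidableEq α] [DecidableEq β] {A : List α} (f : α → β)
    (hf : Function.Injective f) (hA : ∀ e, A.count e ≤ 2) (e : β) : (A.map f).count e ≤ 2 := by
  by_cases h : e ∈ A.map f
  · obtain ⟨a, -, rfl⟩ := List.mem_map.1 h
    rw [List.count_map_of_injective _ _ hf]; exact hA a
  · rw [List.count_eq_zero_of_not_mem h]; simp

lemma cnt {V : Type*} [DecidableEq V] {U : Set V} (P : Bool → ↥(Uᶜ)) (A : Bool → ↥U)
    (hA : Function.Injective A) (O : List (Sym2 ↥(Uᶜ))) (I : List (Sym2 ↥U)) (B : List Bool)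
    (hO : ∀ e, O.count e ≤ 2) (hI : ∀ e, I.count e ≤ 2) (hB : ∀ e, B.count e ≤ 2) (e : Sym2 V) :
    (O.map (Sym2.map Subtype.val) ++ (I.map (Sym2.map Subtype.val) ++
      B.map (fun t => s((A t : V), (P t : V))))).count e ≤ 2 := by
  refine count_append_le ?_ (count_map_le _ (Sym2.map.injective Subtype.val_injective) hO)
    (count_append_le ?_ (count_map_le _ (Sym2.map.injective Subtype.val_injective) hI)
      (count_map_le _ ?_ hB)) e
  · intro e he he'
    obtain ⟨e, -, rfl⟩ := List.mem_map.1 he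
    induction e with | _ x y
    have hx := x.2
    have hy := y.2
    rcases List.mem_append.1 he' with he' | he'
    · obtain ⟨e, -, h⟩ := List.mem_map.1 he'
      induction e with | _ z t
      have hz := z.2
      have ht := t.2
      simp only [Sym2.map_mk, Sym2.eq_iff] at h
      rcases h with ⟨h, -⟩ | ⟨h, -⟩
      · exact hx (h ▸ hz)
      · exact hy (h ▸ hz)
    · obtain ⟨t, -, h⟩ := List.mem_map.1 he'
      have hz := (A t).2
      simp only [Sym2.map_mk, Sym2.eq_iff] at h
      rcases h with ⟨h, -⟩ | ⟨h, -⟩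
      · exact hx (h ▸ hz)
      · exact hy (h ▸ hz)
  · intro e he he'
    obtain ⟨e, -, rfl⟩ := List.mem_map.1 he
    induction e with | _ x y
    have hx := x.2
    have hy := y.2
    obtain ⟨t, -, h⟩ := List.mem_map.1 he'
    have hz := (P t).2
    simp only [Sym2.map_mk, Sym2.eq_iff] at h
    rcases h with ⟨-, h⟩ | ⟨-, h⟩
    · exact hz (h ▸ hy)
    · exact hz (h ▸ hx)
  · intro t s h
    simp only [Sym2.eq_iff] at h
    rcases h with ⟨h, -⟩ | ⟨h, -⟩
    · exact hA (Subtype.ext h)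
    · exact absurd (h ▸ (A t).2) (P s).2

lemma lift_walk {V : Type*} {G : SimpleGraph V} {S : Set V} {a b : ↥S}
    (q : (G.induce S).Walk a b) :
    ∃ q' : G.Walk (a : V) (b : V), q'.support = q.support.map Subtype.val ∧
      q'.edges = q.edges.map (Sym2.map Subtype.val) ∧ q'.length = q.length := by
  induction q with
  | nil => exact ⟨Walk.nil, by simp, by simp, by simp⟩
  | cons h p ih =>
    obtain ⟨q', h1, h2, h3⟩ := ih
    have h' := induce_adj.1 h
    exact ⟨Walk.cons h' q', by simp [h1], by simp [h2], by simp [h3]⟩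

lemma build1 {V : Type*} [DecidableEq V] {G : SimpleGraph V} {U : Set V}
    (P : Bool → ↥(Uᶜ)) (A : Bool → ↥U)
    (hA : Function.Injective A) (hadj : ∀ t, G.Adj (A t) (P t)) {a : ↥(Uᶜ)} {t s : Bool}
    (O₁ : (G.induce Uᶜ).Walk a (P t)) (I : (G.induce U).Walk (A t) (A s))
    (O₂ : (G.induce Uᶜ).Walk (P s) a)
    (hO : ∀ u, u ∈ O₁.support ∨ u ∈ O₂.support) (hI : ∀ u, u ∈ I.support)
    (hcO : ∀ e, (O₁.edges ++ O₂.edges).count e ≤ 2) (hcI : ∀ e, I.edges.count e ≤ 2) :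
    ∃ (b : V) (T : G.Walk b b), (∀ u, u ∈ T.support) ∧ (∀ e, T.edges.count e ≤ 2) ∧
      T.length = O₁.length + O₂.length + I.length + 2 := by
  obtain ⟨o₁, s1, e1, l1⟩ := lift_walk O₁
  obtain ⟨o₂, s2, e2, l2⟩ := lift_walk O₂
  obtain ⟨i, si, ei, li⟩ := lift_walk I
  refine ⟨a, o₁.append (Walk.cons (hadj t).symm (i.append (Walk.cons (hadj s) o₂))), ?_, ?_, ?_⟩
  · intro u
    simp only [Walk.mem_support_append_iff, Walk.support_cons, List.mem_cons, s1, s2, si]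
    by_cases hu : u ∈ U
    · have := List.mem_map_of_mem (f := Subtype.val) (hI ⟨u, hu⟩)
      tauto
    · rcases hO ⟨u, hu⟩ with h | h
      · have := List.mem_map_of_mem (f := Subtype.val) h
        tauto
      · have := List.mem_map_of_mem (f := Subtype.val) h
        tauto
  · intro e
    refine le_of_eq_of_le ?_ (cnt P A hA _ _ [t, s] hcO hcI ?_ e)
    · refine List.Perm.count_eq ?_ e
      simp only [Walk.edges_append, Walk.edges_cons, List.map_append, List.map_cons,
        List.map_nil, e1, e2, ei]
      rw [Sym2.eq_swap (a := (P t : V))]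
      rw [← Multiset.coe_eq_coe]
      simp only [← Multiset.coe_add, ← Multiset.cons_coe, ← Multiset.singleton_add,
        Multiset.coe_nil]
      abel
    · exact fun e => List.count_le_length
  · simp only [Walk.length_append, Walk.length_cons]
    omega

lemma count_four (t s t' s' : Bool) (h : t ≠ s) (h' : t' ≠ s') (e : Bool) :
    [t, s, t', s'].count e ≤ 2 := by
  revert t s t' s' e
  decide

lemma build2 {V : Type*} [DecidableEq V] {G : SimpleGraph V} {U : Set V}
    (P : Bool → ↥(Uᶜ)) (A : Bool → ↥U)
    (hA : Function.Injective A) (hadj : ∀ t, G.Adj (A t) (P t)) {a : ↥(Uᶜ)} {t s t' s' : Bool}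
    (hts : t ≠ s) (hts' : t' ≠ s')
    (O₁ : (G.induce Uᶜ).Walk a (P t)) (I : (G.induce U).Walk (A t) (A s))
    (O₂ : (G.induce Uᶜ).Walk (P s) (P t')) (I' : (G.induce U).Walk (A t') (A s'))
    (O₃ : (G.induce Uᶜ).Walk (P s') a)
    (hO : ∀ u, u ∈ O₁.support ∨ u ∈ O₂.support ∨ u ∈ O₃.support)
    (hI : ∀ u, u ∈ I.support ∨ u ∈ I'.support)
    (hcO : ∀ e, (O₁.edges ++ (O₂.edges ++ O₃.edges)).count e ≤ 2)
    (hcI : ∀ e, (I.edges ++ I'.edges).count e ≤ 2) :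
    ∃ (b : V) (T : G.Walk b b), (∀ u, u ∈ T.support) ∧ (∀ e, T.edges.count e ≤ 2) ∧
      T.length = O₁.length + O₂.length + O₃.length + I.length + I'.length + 4 := by
  obtain ⟨o₁, s1, e1, l1⟩ := lift_walk O₁
  obtain ⟨o₂, s2, e2, l2⟩ := lift_walk O₂
  obtain ⟨o₃, s3, e3, l3⟩ := lift_walk O₃
  obtain ⟨i, si, ei, li⟩ := lift_walk I
  obtain ⟨i', si', ei', li'⟩ := lift_walk I'
  refine ⟨a, o₁.append (Walk.cons (hadj t).symm (i.append (Walk.cons (hadj s) (o₂.append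
      (Walk.cons (hadj t').symm (i'.append (Walk.cons (hadj s') o₃))))))), ?_, ?_, ?_⟩
  · intro u
    simp only [Walk.mem_support_append_iff, Walk.support_cons, List.mem_cons, s1, s2, s3, si, si']
    by_cases hu : u ∈ U
    · rcases hI ⟨u, hu⟩ with h | h
      · have := List.mem_map_of_mem (f := Subtype.val) h
        tauto
      · have := List.mem_map_of_mem (f := Subtype.val) h
        tauto
    · rcases hO ⟨u, hu⟩ with h | h | h
      · have := List.mem_map_of_mem (f := Subtype.val) h
        tauto
      · have := List.mem_map_of_mem (f := Subtype.val) h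
        tauto
      · have := List.mem_map_of_mem (f := Subtype.val) h
        tauto
  · intro e
    refine le_of_eq_of_le ?_ (cnt P A hA _ _ [t, s, t', s'] hcO hcI
      (count_four _ _ _ _ hts hts') e)
    refine List.Perm.count_eq ?_ e
    simp only [Walk.edges_append, Walk.edges_cons, List.map_append, List.map_cons,
      List.map_nil, e1, e2, e3, ei, ei']
    rw [Sym2.eq_swap (a := (P t : V)), Sym2.eq_swap (a := (P t' : V))]
    rw [← Multiset.coe_eq_coe]
    simp only [← Multiset.coe_add, ← Multiset.cons_coe, ← Multiset.singleton_add,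
      Multiset.coe_nil]
    abel
  · simp only [Walk.length_append, Walk.length_cons]
    omega

/-- A list containing all four right vertices has length at least four. -/
lemma four_le {α : Type*} (L : List (α ⊕ Fin 4)) (h : ∀ i, Sum.inr i ∈ L) : 4 ≤ L.length := by
  have hnd : ((List.finRange 4).map (Sum.inr : Fin 4 → α ⊕ Fin 4)).Nodup :=
    (List.nodup_finRange 4).map Sum.inr_injective
  have := (List.subperm_of_subset hnd (l₂ := L) (by
    intro x hx
    obtain ⟨i, -, rfl⟩ := List.mem_map.1 hx
    exact h i)).length_le
  simpa using this

lemma closed_four_le {α : Type*} {H : SimpleGraph (α ⊕ Fin 4)} {x : α ⊕ Fin 4} (W : H.Walk x x)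
    (h : ∀ i, Sum.inr i ∈ W.support) : 4 ≤ W.length := by
  cases W with
  | nil =>
    have := four_le _ h
    simp at this
  | cons hadj p =>
    have : 4 ≤ p.support.length := by
      apply four_le
      intro i
      have := h i
      simp only [Walk.support_cons, List.mem_cons] at this
      rcases this with rfl | h
      · simp
      · exact h
    simpa using this

lemma cross_two_le {α : Type*} {H : SimpleGraph α} {x y : α} (hne : x ≠ y) (hadj : ¬ H.Adj x y)
    (W : H.Walk x y) : 2 ≤ W.length := by
  cases W with
  | nil => exact absurd rfl hne
  | cons h p =>
    cases p with
    | nil => exact absurd h hadj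
    | cons h' p => simp

lemma bool_cases (t s t' s' : Bool) (h : ∀ e, [t, s, t', s'].count e ≤ 2) :
    (t = s ∧ t' = s') ∨ (t ≠ s ∧ t' ≠ s') := by
  revert t s t' s'
  decide

lemma bool_six (L : List Bool) (h : ∀ e, L.count e ≤ 2) (h5 : 5 ≤ L.length) : False := by
  have := List.count_true_add_count_false (l := L)
  have := h true
  have := h false
  omega

lemma core {V : Type*} [DecidableEq V] {G : SimpleGraph V} {U : Set V}
    {H : SimpleGraph (↥(Uᶜ) ⊕ Fin 4)}
    (P : Bool → ↥(Uᶜ)) (A : Bool → ↥U) (D : Bool → Fin 4) (n : ℕ)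
    (hA : Function.Injective A) (hD : Function.Injective D) (hadj : ∀ t, G.Adj (A t) (P t))
    (hLL : ∀ a b, H.Adj (Sum.inl a) (Sum.inl b) → (G.induce Uᶜ).Adj a b)
    (hLR : ∀ a i, H.Adj (Sum.inl a) (Sum.inr i) → ∃ t, a = P t ∧ i = D t)
    (hRR : ∀ t s, ¬ H.Adj (Sum.inr (D t)) (Sum.inr (D s)))
    (hham : ∀ t s, t ≠ s → ∃ I : (G.induce U).Walk (A t) (A s), (∀ u, u ∈ I.support) ∧
      I.edges.Nodup ∧ I.length + 1 = n)
    (hcyc : ∀ t, ∃ I : (G.induce U).Walk (A t) (A t), (∀ u, u ∈ I.support) ∧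
      I.edges.Nodup ∧ I.length = n)
    (hsplit : ∀ t s t' s', t ≠ s → t' ≠ s' → ∃ (I : (G.induce U).Walk (A t) (A s))
      (I' : (G.induce U).Walk (A t') (A s')), (∀ u, u ∈ I.support ∨ u ∈ I'.support) ∧
      (I.edges ++ I'.edges).Nodup ∧ I.length + I'.length = n)
    {a : ↥(Uᶜ)} (W : H.Walk (Sum.inl a) (Sum.inl a)) (hspan : ∀ u, u ∈ W.support)
    (hmult : ∀ e, W.edges.count e ≤ 2) :
    ∃ (b : V) (T : G.Walk b b), (∀ u, u ∈ T.support) ∧ (∀ e, T.edges.count e ≤ 2) ∧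
      T.length + 4 ≤ W.length + n := by
  have nd : ∀ {L : List (Sym2 ↥U)}, L.Nodup → ∀ e, L.count e ≤ 2 := fun h e =>
    (List.nodup_iff_count_le_one.1 h e).trans (by norm_num)
  have cO : ∀ (L : List (Sym2 ↥(Uᶜ))), (L.map (Sym2.map Sum.inl)).Subperm W.edges →
      ∀ e, L.count e ≤ 2 := by
    intro L hL e
    have h1 := List.count_map_of_injective L (Sym2.map (Sum.inl : _ → ↥(Uᶜ) ⊕ Fin 4))
      (Sym2.map.injective Sum.inl_injective) e
    rw [← h1]
    exact (hL.count_le _).trans (hmult _)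
  have hXinj : Function.Injective
      (fun t => (s(Sum.inl (P t), Sum.inr (D t)) : Sym2 (↥(Uᶜ) ⊕ Fin 4))) := by
    intro t s h
    simp only [Sym2.eq_iff, Sum.inr.injEq, reduceCtorEq, and_false, or_false] at h
    exact hD h.2
  have cX : ∀ (L : List Bool), (L.map (fun t =>
      (s(Sum.inl (P t), Sum.inr (D t)) : Sym2 (↥(Uᶜ) ⊕ Fin 4)))).Subperm W.edges →
      ∀ e, L.count e ≤ 2 := by
    intro L hL e
    rw [← List.count_map_of_injective L _ hXinj e]
    exact (hL.count_le _).trans (hmult _)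
  have hlen := W.length_edges
  rcases excursion P D hLL hLR W with ⟨q, hs, -⟩ | ⟨t, s, q, E, W', hs, he, hE⟩
  · have := hspan (Sum.inr 0)
    simp [hs] at this
  rcases excursion P D hLL hLR W' with ⟨q', hs', he'⟩ | ⟨t', s', q', E', W'', hs', he', hE'⟩
  ·
    have hEall : ∀ i, Sum.inr i ∈ E.support := by
      intro i
      have := hspan (Sum.inr i)
      simpa [hs, hs'] using this
    have hOall : ∀ u, u ∈ q.support ∨ u ∈ q'.support := by
      intro u
      have := hspan (Sum.inl u)
      simp only [hs, hs', List.mem_append, List.mem_map, Sum.inl.injEq, exists_eq_right] at this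
      rcases this with h | h | h
      · exact Or.inl h
      · simpa using hE _ h
      · exact Or.inr h
    have hcO := cO (q.edges ++ q'.edges) (by
      rw [he, he', List.map_append]
      refine List.Sublist.subperm (List.Sublist.append_left ?_ _)
      exact ((List.sublist_cons_self _ _).trans (List.sublist_append_right _ _)).cons _)
    rw [he, he'] at hlen
    simp only [List.length_append, List.length_cons, List.length_map, Walk.length_edges] at hlen
    by_cases hts : t = s
    · subst hts
      obtain ⟨I, h1, h2, h3⟩ := hcyc t
      obtain ⟨b, T, hT1, hT2, hT3⟩ := build1 P A hA hadj q I q' hOall h1 hcO (nd h2)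
      have := closed_four_le E hEall
      exact ⟨b, T, hT1, hT2, by omega⟩
    · obtain ⟨I, h1, h2, h3⟩ := hham t s hts
      obtain ⟨b, T, hT1, hT2, hT3⟩ := build1 P A hA hadj q I q' hOall h1 hcO (nd h2)
      have := four_le _ hEall
      rw [Walk.length_support] at this
      exact ⟨b, T, hT1, hT2, by omega⟩
  rcases excursion P D hLL hLR W'' with ⟨q'', hs'', he''⟩ | ⟨t'', s'', q'', E'', R, hs'', he'', hE''⟩
  ·
    have hEall : ∀ i, Sum.inr i ∈ E.support ++ E'.support := by
      intro i
      have := hspan (Sum.inr i)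
      simpa [hs, hs', hs''] using this
    have hOall : ∀ u, u ∈ q.support ∨ u ∈ q'.support ∨ u ∈ q''.support := by
      intro u
      have := hspan (Sum.inl u)
      simp only [hs, hs', hs'', List.mem_append, List.mem_map, Sum.inl.injEq, exists_eq_right]
        at this
      rcases this with h | h | h | h | h
      · exact Or.inl h
      · simpa using hE _ h
      · exact Or.inr (Or.inl h)
      · simpa using hE' _ h
      · exact Or.inr (Or.inr h)
    have hcO := cO (q.edges ++ (q'.edges ++ q''.edges)) (by
      rw [he, he', he'', List.map_append, List.map_append]
      refine List.Sublist.subperm (List.Sublist.append_left ?_ _)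
      refine List.Sublist.cons _ (List.Sublist.trans ?_ (List.sublist_append_right _ _))
      refine List.Sublist.cons _ (List.Sublist.append_left ?_ _)
      refine List.Sublist.cons _ (List.Sublist.trans ?_ (List.sublist_append_right _ _))
      exact List.sublist_cons_self _ _)
    have hcX := cX [t, s, t', s'] (by
      rw [he, he', he'']
      simp only [List.map_cons, List.map_nil]
      refine List.Sublist.subperm (List.Sublist.trans ?_ (List.sublist_append_right _ _))
      refine List.Sublist.cons_cons _ (List.Sublist.trans ?_ (List.sublist_append_right _ _))
      refine List.Sublist.cons_cons _ (List.Sublist.trans ?_ (List.sublist_append_right _ _))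
      refine List.Sublist.cons_cons _ (List.Sublist.trans ?_ (List.sublist_append_right _ _))
      exact List.Sublist.cons_cons _ (List.nil_sublist _))
    rw [he, he', he''] at hlen
    simp only [List.length_append, List.length_cons, List.length_map, Walk.length_edges] at hlen
    rcases bool_cases _ _ _ _ hcX with ⟨rfl, rfl⟩ | ⟨h, h'⟩
    · obtain ⟨I, h1, h2, h3⟩ := hcyc t
      obtain ⟨b, T, hT1, hT2, hT3⟩ := build1 P A hA hadj q I (q'.append q'')
        (by simpa [Walk.mem_support_append_iff] using hOall) h1
        (by simpa [Walk.edges_append] using hcO) (nd h2)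
      have := four_le _ hEall
      rw [List.length_append, Walk.length_support, Walk.length_support] at this
      rw [Walk.length_append] at hT3
      exact ⟨b, T, hT1, hT2, by omega⟩
    · obtain ⟨I, I', h1, h2, h3⟩ := hsplit t s t' s' h h'
      obtain ⟨b, T, hT1, hT2, hT3⟩ := build2 P A hA hadj h h' q I q' I' q'' hOall h1 hcO (nd h2)
      have := cross_two_le (fun hh => h (hD (Sum.inr_injective hh))) (hRR _ _) E
      have := cross_two_le (fun hh => h' (hD (Sum.inr_injective hh))) (hRR _ _) E'
      exact ⟨b, T, hT1, hT2, by omega⟩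
  ·
    exfalso
    refine bool_six [t, s, t', s', t''] (cX _ ?_) (by simp)
    rw [he, he', he'']
    simp only [List.map_cons, List.map_nil]
    refine List.Sublist.subperm (List.Sublist.trans ?_ (List.sublist_append_right _ _))
    refine List.Sublist.cons_cons _ (List.Sublist.trans ?_ (List.sublist_append_right _ _))
    refine List.Sublist.cons_cons _ (List.Sublist.trans ?_ (List.sublist_append_right _ _))
    refine List.Sublist.cons_cons _ (List.Sublist.trans ?_ (List.sublist_append_right _ _))
    refine List.Sublist.cons_cons _ (List.Sublist.trans ?_ (List.sublist_append_right _ _))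
    exact List.Sublist.cons_cons _ (List.nil_sublist _)

end Stmt5Aux

/-- Lemma on replacing a 2-edge-cut part having a Hamiltonian cycle and a Hamiltonian
path between the attachment vertices by a chorded 4-cycle: every tour of the reduced
graph `H` yields a tour of `G` of length at most `|T'| + |U| − 4`. -/
theorem stmt5 {V : Type*} [Fintype V] [DecidableEq V] (G : SimpleGraph V)
    (U : Set V) (v w p₁ p₂ : V)
    (hvU : v ∈ U) (hwU : w ∈ U) (hvw : v ≠ w) (hp₁ : p₁ ∉ U) (hp₂ : p₂ ∉ U)
    (hadj₁ : G.Adj v p₁) (hadj₂ : G.Adj w p₂)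
    (hcut : {e : Sym2 V | e ∈ G.edgeSet ∧ ∃ x y : V, e = s(x, y) ∧ x ∈ U ∧ y ∉ U}
      = {s(v, p₁), s(w, p₂)})
    (hcyc : ∃ (x : ↥U) (c : (G.induce U).Walk x x), c.IsHamiltonianCycle)
    (hpath : ∃ p : (G.induce U).Walk ⟨v, hvU⟩ ⟨w, hwU⟩, p.IsHamiltonian)
    (a : (↥(Uᶜ)) ⊕ Fin 4) (T' : (replaceByChordedSquare G U p₁ p₂).Walk a a)
    (hT'span : ∀ u, u ∈ T'.support)
    (hT'mult : ∀ e, T'.edges.count e ≤ 2) :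
    ∃ (b : V) (T : G.Walk b b),
      (∀ u : V, u ∈ T.support) ∧
      (∀ e : Sym2 V, T.edges.count e ≤ 2) ∧
      (T.length : ℝ) ≤ (T'.length : ℝ) + (U.ncard : ℝ) - 4 := by
  classical
  have : Fintype ↥U := Fintype.ofFinite _
  obtain ⟨x, c, hc⟩ := hcyc
  obtain ⟨p, hp⟩ := hpath
  set P : Bool → ↥(Uᶜ) := fun t => if t then ⟨p₁, hp₁⟩ else ⟨p₂, hp₂⟩ with hP
  set A : Bool → ↥U := fun t => if t then ⟨v, hvU⟩ else ⟨w, hwU⟩ with hAdef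
  set D : Bool → Fin 4 := fun t => if t then 1 else 3 with hDdef
  have hn : U.ncard = Fintype.card ↥U := by
    rw [← Nat.card_coe_set_eq, Nat.card_eq_fintype_card]
  have hA : Function.Injective A := by
    intro t s h
    cases t <;> cases s <;> simp_all
  have hpos : 0 < Fintype.card ↥U := Fintype.card_pos_iff.2 ⟨x⟩
  have hc2 : ∀ t, ∃ I : (G.induce U).Walk (A t) (A t), (∀ u, u ∈ I.support) ∧
      I.edges.Nodup ∧ I.length = Fintype.card ↥U := by
    intro t
    refine ⟨c.rotate (A t) (hc.mem_support _), ?_, ?_, ?_⟩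
    · intro u
      rw [Walk.mem_support_rotate_iff]
      exact hc.mem_support u
    · rw [(c.rotate_edges _ _).perm.nodup_iff]
      exact hc.isCycle.edges_nodup
    · rw [Walk.length_rotate]
      exact hc.length_eq
  have hsplit0 : ∃ (I I' : (G.induce U).Walk (A true) (A false)),
      (∀ u, u ∈ I.support ∨ u ∈ I'.support) ∧ (I.edges ++ I'.edges).Nodup ∧
      I.length + I'.length = Fintype.card ↥U := by
    obtain ⟨I, h1, h2, h3⟩ := hc2 true
    have hsp := I.take_spec (h1 (A false))
    refine ⟨I.takeUntil _ (h1 (A false)), (I.dropUntil _ (h1 (A false))).reverse, ?_, ?_, ?_⟩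
    · intro u
      have := h1 u
      rw [← hsp, Walk.mem_support_append_iff] at this
      simpa using this
    · rw [← hsp, Walk.edges_append] at h2
      rw [Walk.edges_reverse]
      exact (List.Perm.append_left _ (List.reverse_perm _)).nodup_iff.2 h2
    · rw [← hsp, Walk.length_append] at h3
      simpa using h3
  have key := fun (b : ↥(Uᶜ)) => Stmt5Aux.core (G := G) (H := replaceByChordedSquare G U p₁ p₂)
    P A D (Fintype.card ↥U) hA
    (by intro t s h; cases t <;> cases s <;> simp_all)
    (by intro t; cases t <;> simp [hP, hAdef, hadj₁, hadj₂])
    (by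
      intro a b h
      simp only [replaceByChordedSquare, fromRel_adj] at h
      rcases h.2 with h | h
      · exact h
      · exact h.symm)
    (by
      intro a i h
      simp only [replaceByChordedSquare, fromRel_adj] at h
      rcases h.2 with (h | h) | h
      · exact ⟨true, Subtype.ext h.1, h.2⟩
      · exact ⟨false, Subtype.ext h.1, h.2⟩
      · exact h.elim)
    (by
      intro t s h
      simp only [replaceByChordedSquare, fromRel_adj] at h
      cases t <;> cases s <;> simp [hDdef] at h)
    (by
      have h1 : p.edges.Nodup := hp.isPath.isTrail.edges_nodup
      have h2 : p.length + 1 = Fintype.card ↥U := by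
        have := hp.length_eq
        omega
      intro t s hts
      cases t <;> cases s
      · exact absurd rfl hts
      · exact ⟨p.reverse, by simpa using hp.mem_support,
          by simpa using h1, by simpa using h2⟩
      · exact ⟨p, hp.mem_support, h1, h2⟩
      · exact absurd rfl hts)
    hc2
    (by
      obtain ⟨I, I', h1, h2, h3⟩ := hsplit0
      intro t s t' s' hts hts'
      have e1 := (List.Perm.append_left I.edges (List.reverse_perm I'.edges)).nodup_iff.2 h2
      have e2 := (List.Perm.append_right I'.edges (List.reverse_perm I.edges)).nodup_iff.2 h2
      have e3 := (List.Perm.append (List.reverse_perm I.edges)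
        (List.reverse_perm I'.edges)).nodup_iff.2 h2
      cases t <;> cases s <;> first | exact absurd rfl hts | skip
      all_goals cases t' <;> cases s' <;> first | exact absurd rfl hts' | skip
      · exact ⟨I.reverse, I'.reverse, by simpa using h1,
          by rw [Walk.edges_reverse, Walk.edges_reverse]; exact e3, by simpa using h3⟩
      · exact ⟨I.reverse, I', by simpa using h1,
          by rw [Walk.edges_reverse]; exact e2, by simpa using h3⟩
      · exact ⟨I, I'.reverse, by simpa using h1,
          by rw [Walk.edges_reverse]; exact e1, by simpa using h3⟩
      · exact ⟨I, I', h1, h2, h3⟩)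
    (a := b)
  obtain ⟨b, T, h1, h2, h3⟩ := key ⟨p₁, hp₁⟩ (T'.rotate _ (hT'span _))
    (by
      intro u
      rw [Walk.mem_support_rotate_iff]
      exact hT'span u)
    (by
      intro e
      rw [(T'.rotate_edges _ _).perm.count_eq]
      convert hT'mult e)
  refine ⟨b, T, h1, ?_, ?_⟩
  · intro e
    convert h2 e
  · rw [Walk.length_rotate] at h3
    rw [hn]
    have : ((T.length + 4 : ℕ) : ℝ) ≤ ((T'.length + Fintype.card ↥U : ℕ) : ℝ) := by
      exact_mod_cast h3
    push_cast at this
    linarith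
end

section
/- Let G = (V,E) be a simple graph and U ⊂ V a set with |U| = 7 such that exactly three edges e_1, e_2, e_3 of G have exactly one endpoint in U; let v_1, v_2, v_3 ∈ U be their (distinct) endpoints inside U and p_1, p_2, p_3 their endpoints outside U. Suppose the induced subgraph G[U] contains a closed walk of length at most 8 that uses each edge at most once and visits every vertex of U, and that for every pair of distinct vertices v, w ∈ {v_1, v_2, v_3} the graph G[U] contains a walk from v to w of length at most 7 that uses each edge at most once and visits every vertex of U. Let H be the graph with vertex set (V ∖ U) ∪ {t_1, t_2, t_3} (three new vertices) whose edges are: all edges of G with both endpoints in V ∖ U, the triangle edges t_1t_2, t_2t_3, t_3t_1, and the edges p_1t_1, p_2t_2, p_3t_3. Then for every tour T' of H there exists a tour T of G of length at most |T'| + 5. -/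
open SimpleGraph

/-- The graph `H` obtained from `G` by replacing the part `G[U]` by a triangle on three
new vertices `t₁, t₂, t₃` (indices `0,1,2`): edges of `G` with both endpoints outside `U`,
the triangle edges, and the edges `pᵢtᵢ`. -/
def replaceByTriangle {V : Type*} (G : SimpleGraph V) (U : Set V) (ps : Fin 3 → V) :
    SimpleGraph ((↥(Uᶜ)) ⊕ Fin 3) :=
  SimpleGraph.fromRel (fun a b =>
    match a, b with
    | Sum.inl a, Sum.inl b => G.Adj (a : V) (b : V)
    | Sum.inr _, Sum.inr _ => True
    | Sum.inl a, Sum.inr j => (a : V) = ps j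
    | Sum.inr _, Sum.inl _ => False)

namespace TourAux

open Classical in
/-- Degree parity of a walk. -/
theorem walk_parity {W : Type*} {H : SimpleGraph W} {a b : W} (p : H.Walk a b) (x : W)
    [DecidablePred (fun e : Sym2 W => x ∈ e)] :
    Even (p.edges.countP (fun e => x ∈ e) + (if x = a then 1 else 0) + (if x = b then 1 else 0)) := by
  induction p with
  | nil =>
    simp only [Walk.edges_nil, List.countP_nil]
    split_ifs <;> decide
  | @cons u v w h p ih =>
    have huv : u ≠ v := h.ne
    rw [Walk.edges_cons, List.countP_cons]
    simp only [Sym2.mem_iff, decide_eq_true_eq]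
    rw [Nat.even_iff] at *
    by_cases h1 : x = u
    · have h2 : x ≠ v := fun h => huv (h1 ▸ h)
      simp only [h1, huv, true_or, if_true, if_false] at ih ⊢
      omega
    · by_cases h2 : x = v
      · simp only [h2, huv.symm, or_true, if_true, if_false] at ih ⊢
        omega
      · simp only [h1, h2, or_self, if_false] at ih ⊢
        omega

theorem walk_conn {V W : Type*} {H : SimpleGraph W} (S : V → V → Prop) (hr : ∀ a, S a a)
    (ht : ∀ a b c, S a b → S b c → S a c) (f : W → V) {a b : W} (p : H.Walk a b)
    (h : ∀ x y, s(x, y) ∈ p.edges → S (f x) (f y)) : ∀ u ∈ p.support, S (f a) (f u) := by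
  induction p with
  | nil => intro u hu; simp at hu; subst hu; exact hr _
  | @cons u v w hh p ih =>
    intro z hz
    rw [Walk.support_cons, List.mem_cons] at hz
    rcases hz with rfl | hz
    · exact hr _
    · refine ht _ (f v) _ (h _ _ (by simp)) (ih ?_ z hz)
      intro x y hxy
      exact h x y (by rw [Walk.edges_cons]; exact List.mem_cons_of_mem _ hxy)

theorem exists_edge {W : Type*} {H : SimpleGraph W} {a : W} (p : H.Walk a a) {w z : W}
    (hw : w ∈ p.support) (hz : z ∈ p.support) (hne : w ≠ z) : ∃ e ∈ p.edges, w ∈ e := by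
  classical
  by_contra hcon
  push Not at hcon
  have key := walk_conn (fun (a b : Prop) => a ↔ b) (fun _ => Iff.rfl)
    (fun _ _ _ h1 h2 => h1.trans h2) (fun x => x = w) p (by
      intro x y hxy
      have h := hcon _ hxy
      rw [Sym2.mem_iff] at h
      push Not at h
      simp [h.1.symm, h.2.symm])
  have h1 := key w hw
  have h2 := key z hz
  exact hne ((h2.1 (h1.2 rfl)).symm)

open Classical in
theorem crossing {V : Type*} (R : V → V → Prop) (A : V → Prop) {a b : V}
    (h : Relation.ReflTransGen R a b) (ha : A a) (hb : ¬ A b) : ∃ c d, R c d ∧ A c ∧ ¬ A d := by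
  induction h with
  | refl => exact absurd ha hb
  | @tail c d _ hcd ih =>
    by_cases hc : A c
    · exact ⟨c, d, hcd, hc, hb⟩
    · exact ih hc

open Classical in
/-- Euler's theorem for multisets of edges. -/
theorem euler {V : Type*} (v0 : V) (G : SimpleGraph V) (M : Multiset (Sym2 V))
    (hM : ∀ e ∈ M, e ∈ G.edgeSet) (heven : ∀ v, Even (M.countP (fun e => v ∈ e)))
    (hconn : ∀ u v, Relation.ReflTransGen (fun a b => s(a, b) ∈ M) u v) :
    ∃ (b : V) (T : G.Walk b b), (∀ u, u ∈ T.support) ∧ (T.edges : Multiset (Sym2 V)) = M := by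
  let P : ℕ → Prop := fun n => ∃ (a b : V) (p : G.Walk a b), (p.edges : Multiset (Sym2 V)) ≤ M ∧
    p.length = n
  have hbound : ∀ n, P n → n ≤ M.card := by
    rintro n ⟨a, b, p, hp, rfl⟩
    have := Multiset.card_le_card hp
    simpa using this
  have h0 : P 0 := ⟨v0, v0, Walk.nil, by simp, rfl⟩
  obtain ⟨a, b, p, hp, hlen⟩ := Nat.findGreatest_spec (P := P) (Nat.zero_le M.card) h0
  have hmax : ∀ n, P n → n ≤ p.length := by
    intro n hn
    rw [hlen]
    exact Nat.le_findGreatest (hbound n hn) hn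
  have hext : ∀ {a c : V} (q : G.Walk a c) (d : V), (q.edges : Multiset (Sym2 V)) ≤ M →
      q.length = p.length → s(d, a) ∈ M - (q.edges : Multiset (Sym2 V)) → False := by
    intro a c q d hq hl hd
    have hdM : s(d, a) ∈ M := Multiset.mem_of_le (Multiset.sub_le_self _ _) hd
    have hadj : G.Adj d a := hM _ hdM
    have := hmax (q.length + 1) ⟨d, c, Walk.cons hadj q, by
      rw [Walk.edges_cons, ← Multiset.cons_coe, ← Multiset.singleton_add]
      have h1 : ({s(d, a)} : Multiset (Sym2 V)) ≤ M - (q.edges : Multiset (Sym2 V)) :=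
        Multiset.singleton_le.2 hd
      calc _ ≤ (M - (q.edges : Multiset (Sym2 V))) + (q.edges : Multiset (Sym2 V)) := by gcongr
        _ = M := Multiset.sub_add_cancel hq, by simp⟩
    omega
  have hab : a = b := by
    by_contra hne
    have hpar := walk_parity p a
    have hlt : (p.edges : Multiset (Sym2 V)).countP (fun e => a ∈ e) ≠ M.countP (fun e => a ∈ e) := by
      intro h
      have h2 := heven a
      rw [← h, Multiset.coe_countP] at h2
      simp only [if_true, hne, if_false] at hpar
      rw [Nat.even_iff] at h2 hpar
      omega
    have hpos : 0 < (M - (p.edges : Multiset (Sym2 V))).countP (fun e => a ∈ e) := by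
      rw [Multiset.countP_sub hp]
      have := Multiset.countP_le_of_le (fun e => a ∈ e) hp
      omega
    rw [Multiset.countP_pos] at hpos
    obtain ⟨e, he, hae⟩ := hpos
    obtain ⟨d, rfl⟩ := hae
    exact hext p d hp rfl (by rw [Sym2.eq_swap]; exact he)
  subst hab
  have hsupp : ∀ c d, s(c, d) ∈ M - (p.edges : Multiset (Sym2 V)) → c ∉ p.support := by
    intro c d hcd hc
    have hrot : ((p.rotate c hc).edges : Multiset (Sym2 V)) = (p.edges : Multiset (Sym2 V)) :=
      Multiset.coe_eq_coe.2 (p.rotate_edges c hc).perm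
    have hl : (p.rotate c hc).length = p.length := by
      have := congrArg Multiset.card hrot
      simpa using this
    exact hext (p.rotate c hc) d (hrot ▸ hp) hl (by rw [hrot, Sym2.eq_swap]; exact hcd)
  have hall : ∀ u, u ∈ p.support := by
    intro u
    by_contra hu
    obtain ⟨c, d, hcd, hc, hd⟩ := crossing _ (fun x => x ∈ p.support) (hconn a u)
      p.start_mem_support hu
    refine hsupp c d ?_ hc
    have : s(c, d) ∉ (p.edges : Multiset (Sym2 V)) := by
      intro h
      exact hd (p.snd_mem_support_of_mem_edges h)
    rw [← Multiset.count_pos, Multiset.count_sub, Multiset.count_eq_zero.2 this]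
    simpa [Multiset.count_pos] using hcd
  refine ⟨a, p, hall, ?_⟩
  by_contra hne
  have h1 : M - (p.edges : Multiset (Sym2 V)) ≠ 0 := by
    intro h
    exact hne (le_antisymm hp (tsub_eq_zero_iff_le.1 h))
  obtain ⟨e, he⟩ := Multiset.exists_mem_of_ne_zero h1
  induction e with
  | _ c d => exact hsupp c d he (hall c)

/-- decomposition of the edges of `H`. -/
theorem decomp {V : Type*} (G : SimpleGraph V) (U : Set V) (ps : Fin 3 → V)
    (hps : ∀ i, ps i ∉ U) (E : Multiset (Sym2 ((↥(Uᶜ)) ⊕ Fin 3)))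
    (hE : ∀ e ∈ E, e ∈ (replaceByTriangle G U ps).edgeSet) :
    ∃ (O : Multiset (Sym2 (↥(Uᶜ)))) (x y : Fin 3 → ℕ),
      (∀ e ∈ O, e.map Subtype.val ∈ G.edgeSet) ∧
      E = O.map (Sym2.map Sum.inl) + ∑ i, x i • {s(Sum.inl ⟨ps i, hps i⟩, Sum.inr i)}
        + ∑ i, y i • {s(Sum.inr (i + 1), Sum.inr (i + 2))} := by
  induction E using Multiset.induction with
  | empty => exact ⟨0, 0, 0, by simp, by simp⟩
  | cons e E ih =>
    obtain ⟨O, x, y, hO, rfl⟩ := ih (fun e he => hE e (Multiset.mem_cons_of_mem he))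
    have he := hE e (Multiset.mem_cons_self _ _)
    have hx : ∀ k : Fin 3, s(Sum.inl ⟨ps k, hps k⟩, Sum.inr k) = e → ∃ (O' : Multiset (Sym2 (↥(Uᶜ)))) (x' y' : Fin 3 → ℕ),
      (∀ e ∈ O', e.map Subtype.val ∈ G.edgeSet) ∧
      e ::ₘ (O.map (Sym2.map Sum.inl) + ∑ i, x i • {s(Sum.inl ⟨ps i, hps i⟩, Sum.inr i)}
        + ∑ i, y i • {s(Sum.inr (i + 1), Sum.inr (i + 2))}) = O'.map (Sym2.map Sum.inl) + ∑ i, x' i • {s(Sum.inl ⟨ps i, hps i⟩, Sum.inr i)}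
        + ∑ i, y' i • {s(Sum.inr (i + 1), Sum.inr (i + 2))} := by
      rintro k rfl
      refine ⟨O, x + Pi.single k 1, y, hO, ?_⟩
      simp only [Pi.add_apply, add_smul, Finset.sum_add_distrib]
      rw [Finset.sum_eq_single (f := fun i => (Pi.single k 1 : Fin 3 → ℕ) i • ({s(Sum.inl ⟨ps i, hps i⟩, Sum.inr i)} : Multiset (Sym2 ((↥(Uᶜ)) ⊕ Fin 3)))) k
        (by intro b _ hb; simp [hb]) (by simp)]
      rw [← Multiset.singleton_add, Pi.single_eq_same, one_smul]
      abel
    have hy : ∀ k : Fin 3, s(Sum.inr (k + 1), Sum.inr (k + 2)) = e → ∃ (O' : Multiset (Sym2 (↥(Uᶜ)))) (x' y' : Fin 3 → ℕ),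
      (∀ e ∈ O', e.map Subtype.val ∈ G.edgeSet) ∧
      e ::ₘ (O.map (Sym2.map Sum.inl) + ∑ i, x i • {s(Sum.inl ⟨ps i, hps i⟩, Sum.inr i)}
        + ∑ i, y i • {s(Sum.inr (i + 1), Sum.inr (i + 2))}) = O'.map (Sym2.map Sum.inl) + ∑ i, x' i • {s(Sum.inl ⟨ps i, hps i⟩, Sum.inr i)}
        + ∑ i, y' i • {s(Sum.inr (i + 1), Sum.inr (i + 2))} := by
      rintro k rfl
      refine ⟨O, x, y + Pi.single k 1, hO, ?_⟩
      simp only [Pi.add_apply, add_smul, Finset.sum_add_distrib]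
      rw [Finset.sum_eq_single (f := fun i => (Pi.single k 1 : Fin 3 → ℕ) i • ({s(Sum.inr (i + 1), Sum.inr (i + 2))} : Multiset (Sym2 ((↥(Uᶜ)) ⊕ Fin 3)))) k
        (by intro b _ hb; simp [hb]) (by simp)]
      rw [← Multiset.singleton_add, Pi.single_eq_same, one_smul]
      abel
    induction e with
    | _ a b =>
      rw [mem_edgeSet, replaceByTriangle, fromRel_adj] at he
      obtain ⟨hne, he⟩ := he
      rcases a with a | i <;> rcases b with b | j
      · refine ⟨s(a, b) ::ₘ O, x, y, ?_, ?_⟩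
        · intro e he'
          rcases Multiset.mem_cons.1 he' with rfl | he'
          · simpa [G.adj_comm] using he
          · exact hO e he'
        · simp [Multiset.cons_add]
      · have h : (a : V) = ps j := by simpa using he
        obtain ⟨x, hx'⟩ := a
        dsimp only at h
        subst h
        exact hx j rfl
      · have h : (b : V) = ps i := by simpa using he
        obtain ⟨x, hx'⟩ := b
        dsimp only at h
        subst h
        exact hx i Sym2.eq_swap
      · have hij : i ≠ j := by simpa using hne
        fin_cases i <;> fin_cases j <;> first | exact absurd rfl hij | skip
        · exact hy 2 rfl
        · exact hy 1 Sym2.eq_swap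
        · exact hy 2 Sym2.eq_swap
        · exact hy 0 rfl
        · exact hy 1 rfl
        · exact hy 0 Sym2.eq_swap

theorem choice (x y : Fin 3 → ℕ) (hx : ∀ i, x i ≤ 2)
    (hpar : ∀ k, Even (x k + y (k + 1) + y (k + 2)))
    (hpos : ∀ k, 0 < x k + y (k + 1) + y (k + 2)) :
    ∃ x' : Fin 3 → ℕ,
      (∀ k, x' k = x k ∨ (x' k = 0 ∧ x k = 2 ∧ y (k + 1) = 0 ∧ y (k + 2) = 0)) ∧
      (∃ k, x' k = x k) ∧
      (((∀ k, Even (x k)) ∧ x' 0 + x' 1 + x' 2 + 8 ≤ x 0 + x 1 + x 2 + y 0 + y 1 + y 2 + 5) ∨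
       (∃ i j, i ≠ j ∧ (∀ k, Even (x k + (if k = i then 1 else 0) + (if k = j then 1 else 0))) ∧
        x' 0 + x' 1 + x' 2 + 7 ≤ x 0 + x 1 + x 2 + y 0 + y 1 + y 2 + 5)) := by
  have e1 : (1 : Fin 3) + 1 = 2 := rfl
  have e2 : (1 : Fin 3) + 2 = 0 := rfl
  have e3 : (2 : Fin 3) + 1 = 0 := rfl
  have e4 : (2 : Fin 3) + 2 = 1 := rfl
  simp only [Fin.forall_fin_succ, Fin.exists_fin_succ, Nat.even_iff] at *
  simp [e1, e2, e3, e4] at *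
  obtain ⟨hx0, hx1, hx2⟩ := hx
  obtain ⟨a0, a1, a2⟩ := hpar
  generalize x 0 = p at *
  generalize x 1 = q at *
  generalize x 2 = r at *
  generalize y 0 = u at *
  generalize y 1 = v at *
  generalize y 2 = w at *
  by_cases c0 : p = 2 ∧ v = 0 ∧ w = 0
  · by_cases c1 : q = 2 ∧ u = 0
    · refine ⟨![0, 0, r], ?_⟩
      interval_cases p <;> interval_cases q <;> interval_cases r <;> simp at * <;> omega
    · refine ⟨![0, q, r], ?_⟩
      interval_cases p <;> interval_cases q <;> interval_cases r <;> simp at * <;> omega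
  · by_cases c1 : q = 2 ∧ u = 0 ∧ w = 0
    · refine ⟨![p, 0, r], ?_⟩
      interval_cases p <;> interval_cases q <;> interval_cases r <;> simp at * <;> omega
    · by_cases c2 : r = 2 ∧ u = 0 ∧ v = 0
      · refine ⟨![p, q, 0], ?_⟩
        interval_cases p <;> interval_cases q <;> interval_cases r <;> simp at * <;> omega
      · refine ⟨![p, q, r], ?_⟩
        interval_cases p <;> interval_cases q <;> interval_cases r <;> simp at * <;> omega



theorem countP_sum {α : Type*} (x : Fin 3 → ℕ) (c : Fin 3 → α) (P : α → Prop) [DecidablePred P] :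
    (∑ i, x i • ({c i} : Multiset α)).countP P = ∑ i, x i * (if P (c i) then 1 else 0) := by
  have h : ∀ a : α, ({a} : Multiset α).countP P = if P a then 1 else 0 := by
    intro a
    rw [← Multiset.cons_zero, Multiset.countP_cons]
    simp
  simp only [Fin.sum_univ_three, Multiset.countP_add, Multiset.countP_nsmul, h]

theorem mem_sum {α : Type*} (x : Fin 3 → ℕ) (c : Fin 3 → α) (e : α) :
    e ∈ (∑ i, x i • ({c i} : Multiset α)) ↔ ∃ i, x i ≠ 0 ∧ e = c i := by
  simp only [Multiset.mem_sum, Multiset.mem_nsmul, Multiset.mem_singleton, Finset.mem_univ,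
    true_and]

theorem card_sum {α : Type*} (x : Fin 3 → ℕ) (c : Fin 3 → α) :
    (∑ i, x i • ({c i} : Multiset α)).card = x 0 + x 1 + x 2 := by
  simp [Fin.sum_univ_three]

open Classical in
theorem countP_map_inj {α β : Type*} (f : α → β) (hf : Function.Injective f)
    (O : Multiset (Sym2 α)) (a : α) [DecidablePred (fun e : Sym2 β => f a ∈ e)]
    [DecidablePred (fun e : Sym2 α => a ∈ e)] :
    (O.map (Sym2.map f)).countP (fun e => f a ∈ e) = O.countP (fun e => a ∈ e) := by
  rw [Multiset.countP_map, Multiset.countP_eq_card_filter]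
  congr 1
  apply Multiset.filter_congr
  intro e _
  simp only [Sym2.mem_map]
  constructor
  · rintro ⟨b, hb, h⟩
    exact hf h ▸ hb
  · intro h
    exact ⟨a, h, rfl⟩

open Classical in
theorem countP_map_zero {α β : Type*} (f : α → β)
    (O : Multiset (Sym2 α)) (b : β) (hb : ∀ a, f a ≠ b)
    [DecidablePred (fun e : Sym2 β => b ∈ e)] :
    (O.map (Sym2.map f)).countP (fun e => b ∈ e) = 0 := by
  rw [Multiset.countP_eq_zero]
  intro e he h
  obtain ⟨e', _, rfl⟩ := Multiset.mem_map.1 he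
  obtain ⟨a, _, h⟩ := Sym2.mem_map.1 h
  exact hb a h

/-- The piece placed on `U`. -/
theorem inside {V : Type*} (G : SimpleGraph V)
    (U : Set V) {a b : ↥U} (q : (G.induce U).Walk a b) (hq : q.IsTrail)
    (hspan : ∀ u : ↥U, u ∈ q.support) :
    ∃ C : Multiset (Sym2 ↥U), C.Nodup ∧ C.card = q.length ∧
      (∀ e ∈ C, e.map Subtype.val ∈ G.edgeSet) ∧
      (∀ S : V → V → Prop, (∀ a, S a a) → (∀ a b c, S a b → S b c → S a c) →
        (∀ a b, S a b → S b a) → (∀ x y : ↥U, s(x, y) ∈ C → S x y) → ∀ x y : ↥U, S x y) ∧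
      (∀ D : DecidableEq ↥U, ∀ u : ↥U, Even (C.countP (fun e => u ∈ e) + (if u = a then 1 else 0)
        + (if u = b then 1 else 0))) := by
  refine ⟨q.edges, by simpa using hq.edges_nodup, by simp, ?_, ?_, ?_⟩
  · intro e he
    have := q.edges_subset_edgeSet (Multiset.mem_coe.1 he)
    induction e with
    | _ x y => simpa using this
  · intro S hr ht hs h x y
    have key := walk_conn S hr ht Subtype.val q (fun x y hxy => h x y hxy)
    exact ht _ _ _ (hs _ _ (key x (hspan x))) (key y (hspan y))
  · intro D u
    have := walk_parity q u
    rw [Multiset.coe_countP]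
    convert this

open Classical in
theorem main {V : Type*} (G : SimpleGraph V)
    (U : Set V)
    (vs ps : Fin 3 → V)
    (hvs : ∀ i, vs i ∈ U) (hvsinj : Function.Injective vs)
    (hps : ∀ i, ps i ∉ U)
    (hadj : ∀ i, G.Adj (vs i) (ps i))
    (hclosed : ∃ (x : ↥U) (c : (G.induce U).Walk x x),
      c.IsTrail ∧ c.length ≤ 8 ∧ ∀ u : ↥U, u ∈ c.support)
    (hpaths : ∀ i j : Fin 3, i ≠ j →
      ∃ p : (G.induce U).Walk ⟨vs i, hvs i⟩ ⟨vs j, hvs j⟩,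
        p.IsTrail ∧ p.length ≤ 7 ∧ ∀ u : ↥U, u ∈ p.support)
    (a : (↥(Uᶜ)) ⊕ Fin 3) (T' : (replaceByTriangle G U ps).Walk a a)
    (hT'span : ∀ u, u ∈ T'.support)
    (hT'mult : ∀ e, T'.edges.count e ≤ 2) :
    ∃ (b : V) (T : G.Walk b b),
      (∀ u : V, u ∈ T.support) ∧
      (∀ e : Sym2 V, T.edges.count e ≤ 2) ∧
      T.length ≤ T'.length + 5 := by
  obtain ⟨O, x, y, hO, hE⟩ := decomp G U ps hps (T'.edges : Multiset (Sym2 ((↥(Uᶜ)) ⊕ Fin 3)))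
    (fun e he => T'.edges_subset_edgeSet (Multiset.mem_coe.1 he))
  have hmult : ∀ e, (T'.edges : Multiset (Sym2 ((↥(Uᶜ)) ⊕ Fin 3))).count e ≤ 2 := by
    intro e; rw [Multiset.coe_count]; exact hT'mult e
  have hlen : T'.length = O.card + (x 0 + x 1 + x 2) + (y 0 + y 1 + y 2) := by
    have := congrArg Multiset.card hE
    rw [Multiset.card_add, Multiset.card_add, card_sum, card_sum, Multiset.card_map,
      Multiset.coe_card, Walk.length_edges] at this
    exact this
  -- parity in H
  have hpar : ∀ w, Even ((T'.edges : Multiset (Sym2 ((↥(Uᶜ)) ⊕ Fin 3))).countP (fun e => w ∈ e)) := by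
    intro w
    have := walk_parity T' w
    rw [Multiset.coe_countP]
    rw [Nat.even_iff] at *
    split_ifs at this <;> omega
  have hdegt : ∀ k : Fin 3, (T'.edges : Multiset (Sym2 ((↥(Uᶜ)) ⊕ Fin 3))).countP (fun e => Sum.inr k ∈ e) =
      x k + y (k + 1) + y (k + 2) := by
    intro k
    rw [hE, Multiset.countP_add, Multiset.countP_add, countP_map_zero Sum.inl O (Sum.inr k) (by simp), countP_sum,
      countP_sum]
    simp only [Sym2.mem_iff, Sum.inr.injEq, reduceCtorEq, false_or]
    fin_cases k <;> simp [Fin.sum_univ_three] <;> omega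
  have hdego : ∀ w : ↥(Uᶜ), (T'.edges : Multiset (Sym2 ((↥(Uᶜ)) ⊕ Fin 3))).countP (fun e => Sum.inl w ∈ e) =
      O.countP (fun e => w ∈ e) + ∑ i, x i * (if (w : V) = ps i then 1 else 0) := by
    intro k
    rw [hE, Multiset.countP_add, Multiset.countP_add, countP_map_inj _ Sum.inl_injective,
      countP_sum, countP_sum]
    simp [Subtype.ext_iff]
  have hx2 : ∀ i, x i ≤ 2 := by
    intro i
    have h := hmult s(Sum.inl ⟨ps i, hps i⟩, Sum.inr i)
    rw [hE, Multiset.count_add, Multiset.count_add] at h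
    have h2 := countP_sum x (fun i => (s(Sum.inl ⟨ps i, hps i⟩, Sum.inr i) :
      Sym2 ((↥(Uᶜ)) ⊕ Fin 3))) (fun e => s(Sum.inl ⟨ps i, hps i⟩, Sum.inr i) = e)
    have h3 := Finset.single_le_sum (f := fun j => x j * (if
      (s(Sum.inl ⟨ps i, hps i⟩, Sum.inr i) : Sym2 ((↥(Uᶜ)) ⊕ Fin 3)) =
        s(Sum.inl ⟨ps j, hps j⟩, Sum.inr j) then 1 else 0)) (fun _ _ => Nat.zero_le _)
        (Finset.mem_univ i)
    simp only [if_true, mul_one] at h3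
    rw [← h2] at h3
    change x i ≤ Multiset.count _ _ at h3
    omega
  have hpos : ∀ k, 0 < x k + y (k + 1) + y (k + 2) := by
    intro k
    rw [← hdegt k, Multiset.countP_pos]
    obtain ⟨e, he, h⟩ := exists_edge T' (hT'span (Sum.inr k)) (hT'span (Sum.inl ⟨ps 0, hps 0⟩))
      (by simp)
    exact ⟨e, Multiset.mem_coe.2 he, h⟩
  have hoO : ∀ e, O.count e ≤ 2 := by
    intro e
    have h := hmult (e.map Sum.inl)
    rw [hE, Multiset.count_add, Multiset.count_add,
      Multiset.count_map_eq_count' _ _ (Sym2.map.injective Sum.inl_injective)] at h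
    omega
  obtain ⟨x', hx', ⟨k0, hk0⟩, hcase⟩ := choice x y hx2 (fun k => by rw [← hdegt k]; exact hpar _) hpos
  have hx'par : ∀ k, x' k % 2 = x k % 2 := by
    intro k
    rcases hx' k with h | h <;> omega
  -- the inside
  obtain ⟨C, hCnd, hCcard, hCG, hCconn, hCpar⟩ : ∃ C : Multiset (Sym2 ↥U), C.Nodup ∧
      x' 0 + x' 1 + x' 2 + C.card ≤ x 0 + x 1 + x 2 + y 0 + y 1 + y 2 + 5 ∧
      (∀ e ∈ C, e.map Subtype.val ∈ G.edgeSet) ∧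
      (∀ S : V → V → Prop, (∀ a, S a a) → (∀ a b c, S a b → S b c → S a c) →
        (∀ a b, S a b → S b a) → (∀ x y : ↥U, s(x, y) ∈ C → S x y) → ∀ x y : ↥U, S x y) ∧
      (∀ u : ↥U, Even (C.countP (fun e => u ∈ e) +
        ∑ i, x' i * (if (u : V) = vs i then 1 else 0))) := by
    have hsum : ∀ u : ↥U, (∃ k, (u : V) = vs k ∧
        ∑ i, x' i * (if (u : V) = vs i then 1 else 0) = x' k) ∨ ((∀ k, (u : V) ≠ vs k) ∧
        ∑ i, x' i * (if (u : V) = vs i then 1 else 0) = 0) := by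
      intro u
      by_cases h : ∃ k, (u : V) = vs k
      · obtain ⟨k, hk⟩ := h
        refine Or.inl ⟨k, hk, ?_⟩
        simp [hk, hvsinj.eq_iff]
      · push Not at h
        exact Or.inr ⟨h, by simp [h]⟩
    rcases hcase with ⟨hev, hle⟩ | ⟨i, j, hij, hev, hle⟩
    · obtain ⟨z, q, hq, hl, hs⟩ := hclosed
      obtain ⟨C, h1, h2, h3, h4, h5⟩ := inside G U q hq hs
      refine ⟨C, h1, by omega, h3, h4, ?_⟩
      intro u
      have h := h5 inferInstance u
      have h' := hsum u
      rw [Nat.even_iff] at *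
      rcases h' with ⟨k, hk, h'⟩ | ⟨_, h'⟩
      · have := hev k
        have := hx'par k
        rw [Nat.even_iff] at *
        rw [h']
        split_ifs at h <;> omega
      · rw [h']
        split_ifs at h <;> omega
    · obtain ⟨q, hq, hl, hs⟩ := hpaths i j hij
      obtain ⟨C, h1, h2, h3, h4, h5⟩ := inside G U q hq hs
      refine ⟨C, h1, by omega, h3, h4, ?_⟩
      intro u
      have h := h5 inferInstance u
      simp only [Subtype.ext_iff] at h
      have h' := hsum u
      rw [Nat.even_iff] at *
      rcases h' with ⟨k, hk, h'⟩ | ⟨hk, h'⟩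
      · have := hev k
        have := hx'par k
        rw [Nat.even_iff] at *
        rw [h']
        simp only [hk, hvsinj.eq_iff] at h
        split_ifs at * <;> omega
      · rw [h']
        simp only [hk, if_false] at h
        omega
  let c : Fin 3 → Sym2 V := fun i => s(vs i, ps i)
  let M : Multiset (Sym2 V) := O.map (Sym2.map Subtype.val) + ∑ i, x' i • {c i}
    + C.map (Sym2.map Subtype.val)
  have hMO : ∀ e ∈ O, e.map Subtype.val ∈ M := fun e he =>
    Multiset.mem_add.2 (Or.inl (Multiset.mem_add.2 (Or.inl (Multiset.mem_map_of_mem _ he))))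
  have hMC : ∀ e ∈ C, e.map Subtype.val ∈ M := fun e he =>
    Multiset.mem_add.2 (Or.inr (Multiset.mem_map_of_mem _ he))
  have hMc : ∀ i, x' i ≠ 0 → s(vs i, ps i) ∈ M := fun i hi =>
    Multiset.mem_add.2 (Or.inl (Multiset.mem_add.2 (Or.inr ((mem_sum _ _ _).2 ⟨i, hi, rfl⟩))))
  have hMG : ∀ e ∈ M, e ∈ G.edgeSet := by
    intro e he
    rcases Multiset.mem_add.1 he with he | he
    · rcases Multiset.mem_add.1 he with he | he
      · obtain ⟨e', he', rfl⟩ := Multiset.mem_map.1 he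
        exact hO e' he'
      · obtain ⟨i, _, rfl⟩ := (mem_sum _ _ _).1 he
        exact hadj i
    · obtain ⟨e', he', rfl⟩ := Multiset.mem_map.1 he
      exact hCG e' he'
  have hMeven : ∀ v, Even (M.countP (fun e => v ∈ e)) := by
    intro v
    by_cases hv : v ∈ U
    · have h1 : M.countP (fun e => v ∈ e) = C.countP (fun e => (⟨v, hv⟩ : ↥U) ∈ e) +
        ∑ i, x' i * (if v = vs i then 1 else 0) := by
        have hz : ∀ i, v ≠ ps i := fun i h => hps i (h ▸ hv)
        have := countP_map_inj (Subtype.val : ↥U → V) Subtype.val_injective C ⟨v, hv⟩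
        dsimp only at this
        rw [Multiset.countP_add, Multiset.countP_add, countP_sum, this, countP_map_zero]
        · simp [c, hz, add_comm]
        · rintro ⟨a, ha⟩ rfl
          exact ha hv
      rw [h1]
      exact hCpar ⟨v, hv⟩
    · have h1 : M.countP (fun e => v ∈ e) = O.countP (fun e => (⟨v, hv⟩ : ↥(Uᶜ)) ∈ e) +
        ∑ i, x' i * (if v = ps i then 1 else 0) := by
        have hz : ∀ i, v ≠ vs i := fun i h => hv (h ▸ hvs i)
        have := countP_map_inj (Subtype.val : ↥(Uᶜ) → V) Subtype.val_injective O ⟨v, hv⟩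
        dsimp only at this
        rw [Multiset.countP_add, Multiset.countP_add, countP_sum, this,
          countP_map_zero Subtype.val C]
        · simp [c, hz]
        · rintro ⟨a, ha⟩ rfl
          exact hv ha
      have h2 := hpar (Sum.inl ⟨v, hv⟩)
      rw [hdego] at h2
      rw [h1]
      have e0 := hx'par 0
      have e1 := hx'par 1
      have e2 := hx'par 2
      simp only [Fin.sum_univ_three] at h2 ⊢
      rw [Nat.even_iff] at *
      split_ifs at * <;> omega
  have hMcount : ∀ e, M.count e ≤ 2 := by
    intro e
    rw [Multiset.count_add, Multiset.count_add]
    by_cases h1 : e ∈ C.map (Sym2.map Subtype.val)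
    · obtain ⟨e, he, rfl⟩ := Multiset.mem_map.1 h1
      have h2 : e.map Subtype.val ∉ O.map (Sym2.map Subtype.val) := by
        intro h
        obtain ⟨e', he', h⟩ := Multiset.mem_map.1 h
        induction e with
        | _ p q =>
          have hp : (p : V) ∈ Sym2.map Subtype.val e' := by rw [h]; simp
          obtain ⟨r, _, hr⟩ := Sym2.mem_map.1 hp
          exact r.2 (hr ▸ p.2)
      have h3 : e.map Subtype.val ∉ ∑ i, x' i • ({c i} : Multiset (Sym2 V)) := by
        intro h
        obtain ⟨i, _, h⟩ := (mem_sum _ _ _).1 h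
        have hp : ps i ∈ e.map Subtype.val := by rw [h]; simp [c]
        obtain ⟨r, _, hr⟩ := Sym2.mem_map.1 hp
        exact hps i (hr ▸ r.2)
      rw [Multiset.count_eq_zero.2 h2, Multiset.count_eq_zero.2 h3,
        Multiset.count_map_eq_count' _ _ (Sym2.map.injective Subtype.val_injective)]
      have := Multiset.nodup_iff_count_le_one.1 hCnd e
      omega
    · rw [Multiset.count_eq_zero.2 h1]
      by_cases h2 : e ∈ ∑ i, x' i • ({c i} : Multiset (Sym2 V))
      · obtain ⟨i, _, rfl⟩ := (mem_sum _ _ _).1 h2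
        have h3 : c i ∉ O.map (Sym2.map Subtype.val) := by
          intro h
          obtain ⟨e', he', h⟩ := Multiset.mem_map.1 h
          have hp : vs i ∈ Sym2.map Subtype.val e' := by rw [h]; simp [c]
          obtain ⟨r, _, hr⟩ := Sym2.mem_map.1 hp
          exact r.2 (hr ▸ hvs i)
        rw [Multiset.count_eq_zero.2 h3]
        have h4 := countP_sum x' c (fun e => c i = e)
        change Multiset.count _ _ = _ at h4
        rw [h4]
        have hci : ∀ j, c i = c j ↔ i = j := by
          intro j
          constructor
          · intro h
            have : vs i ∈ c j := by rw [← h]; simp [c]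
            rcases Sym2.mem_iff.1 this with h | h
            · exact hvsinj h
            · exact absurd (hvs i) (h ▸ hps j)
          · rintro rfl; rfl
        simp only [hci, mul_ite, mul_one, mul_zero, Finset.sum_ite_eq, Finset.mem_univ, if_true]
        have := hx2 i
        rcases hx' i with h | h <;> omega
      · rw [Multiset.count_eq_zero.2 h2]
        by_cases h3 : e ∈ O.map (Sym2.map Subtype.val)
        · obtain ⟨e, he, rfl⟩ := Multiset.mem_map.1 h3
          rw [Multiset.count_map_eq_count' _ _ (Sym2.map.injective Subtype.val_injective)]
          have := hoO e
          omega
        · rw [Multiset.count_eq_zero.2 h3]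
          omega
  -- connectivity
  have hconn : ∀ u v, Relation.ReflTransGen (fun a b => s(a, b) ∈ M) u v := by
    let S := Relation.ReflTransGen (fun a b => s(a, b) ∈ M)
    have hr : ∀ a, S a a := fun _ => Relation.ReflTransGen.refl
    have ht : ∀ a b c, S a b → S b c → S a c := fun _ _ _ => Relation.ReflTransGen.trans
    have hs : ∀ a b, S a b → S b a := by
      intro a b h
      induction h with
      | refl => exact hr _
      | tail _ h ih => exact Relation.ReflTransGen.head (by rw [Sym2.eq_swap]; exact h) ih
    have hsingle : ∀ a b, s(a, b) ∈ M → S a b := fun a b h => Relation.ReflTransGen.single h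
    have hU : ∀ a b : ↥U, S a b := hCconn S hr ht hs
      (fun a b hab => hsingle _ _ (hMC _ hab))
    let f : (↥(Uᶜ)) ⊕ Fin 3 → V := Sum.elim Subtype.val (fun i => if x' i = x i then vs i else ps i)
    have hstep : ∀ a b, s(a, b) ∈ T'.edges → S (f a) (f b) := by
      intro a b hab
      have hab' : s(a, b) ∈ (T'.edges : Multiset (Sym2 ((↥(Uᶜ)) ⊕ Fin 3))) := hab
      have hcomb : ∀ a' b', s(a, b) = s(a', b') → S (f a') (f b') → S (f a) (f b) := by
        intro a' b' h h'
        rcases Sym2.eq_iff.1 h with ⟨rfl, rfl⟩ | ⟨rfl, rfl⟩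
        · exact h'
        · exact hs _ _ h'
      rw [hE, Multiset.mem_add, Multiset.mem_add, mem_sum, mem_sum] at hab'
      rcases hab' with (h | ⟨i, hi, h⟩) | ⟨i, hi, h⟩
      · obtain ⟨e, he, h⟩ := Multiset.mem_map.1 h
        induction e with
        | _ p q => exact hcomb _ _ h.symm (hsingle _ _ (hMO _ he))
      · refine hcomb _ _ h ?_
        by_cases hxi : x' i = x i
        · simp only [f, Sum.elim_inl, Sum.elim_inr, hxi, if_true]
          exact hs _ _ (hsingle _ _ (hMc i (hxi ▸ hi)))
        · simp only [f, Sum.elim_inl, Sum.elim_inr, hxi, if_false]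
          exact hr _
      · refine hcomb _ _ h ?_
        have k1 : x' (i + 1) = x (i + 1) := by
          rcases hx' (i + 1) with h | ⟨_, _, _, h⟩
          · exact h
          · exfalso
            have : i + 1 + 2 = i := by rw [add_assoc]; exact add_zero i
            rw [this] at h
            exact hi h
        have k2 : x' (i + 2) = x (i + 2) := by
          rcases hx' (i + 2) with h | ⟨_, _, h, _⟩
          · exact h
          · exfalso
            have : i + 2 + 1 = i := by rw [add_assoc]; exact add_zero i
            rw [this] at h
            exact hi h
        simp only [f, Sum.elim_inr, k1, k2, if_true]
        exact hU ⟨_, hvs _⟩ ⟨_, hvs _⟩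
    have key := walk_conn S hr ht f T' hstep
    have hk0' : S (f a) (vs k0) := by
      have := key (Sum.inr k0) (hT'span _)
      simpa only [f, Sum.elim_inr, hk0, if_true] using this
    have hall : ∀ u, S (f a) u := by
      intro u
      by_cases hu : u ∈ U
      · exact ht _ _ _ hk0' (hU ⟨_, hvs k0⟩ ⟨u, hu⟩)
      · exact key (Sum.inl ⟨u, hu⟩) (hT'span _)
    exact fun u v => ht _ _ _ (hs _ _ (hall u)) (hall v)
  obtain ⟨b, T, hT, hTM⟩ := euler (vs 0) G M hMG hMeven hconn
  refine ⟨b, T, hT, ?_, ?_⟩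
  · intro e
    rw [← Multiset.coe_count, hTM]
    exact hMcount e
  · have h1 := congrArg Multiset.card hTM
    rw [Multiset.card_add, Multiset.card_add, card_sum, Multiset.card_map, Multiset.card_map,
      Multiset.coe_card, Walk.length_edges] at h1
    omega

end TourAux

/-- Lemma on replacing a 3-edge-cut part on 7 vertices, having a spanning closed trail of
length at most 8 and spanning trails of length at most 7 between any two attachment
vertices, by a triangle: every tour of the reduced graph `H` yields a tour of `G` of
length at most `|T'| + 5`. -/
theorem stmt6 {V : Type*} [Fintype V] [DecidableEq V] (G : SimpleGraph V)
    (U : Set V) (hU7 : U.ncard = 7)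
    (vs ps : Fin 3 → V)
    (hvs : ∀ i, vs i ∈ U) (hvsinj : Function.Injective vs)
    (hps : ∀ i, ps i ∉ U)
    (hadj : ∀ i, G.Adj (vs i) (ps i))
    (hcut : {e : Sym2 V | e ∈ G.edgeSet ∧ ∃ x y : V, e = s(x, y) ∧ x ∈ U ∧ y ∉ U}
      = {s(vs 0, ps 0), s(vs 1, ps 1), s(vs 2, ps 2)})
    (hclosed : ∃ (x : ↥U) (c : (G.induce U).Walk x x),
      c.IsTrail ∧ c.length ≤ 8 ∧ ∀ u : ↥U, u ∈ c.support)
    (hpaths : ∀ i j : Fin 3, i ≠ j →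
      ∃ p : (G.induce U).Walk ⟨vs i, hvs i⟩ ⟨vs j, hvs j⟩,
        p.IsTrail ∧ p.length ≤ 7 ∧ ∀ u : ↥U, u ∈ p.support)
    (a : (↥(Uᶜ)) ⊕ Fin 3) (T' : (replaceByTriangle G U ps).Walk a a)
    (hT'span : ∀ u, u ∈ T'.support)
    (hT'mult : ∀ e, T'.edges.count e ≤ 2) :
    ∃ (b : V) (T : G.Walk b b),
      (∀ u : V, u ∈ T.support) ∧
      (∀ e : Sym2 V, T.edges.count e ≤ 2) ∧
      T.length ≤ T'.length + 5 := by
  obtain ⟨b, T, h1, h2, h3⟩ := TourAux.main G U vs ps hvs hvsinj hps hadj hclosed hpaths a T' hT'span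
    (fun e => by convert hT'mult e)
  exact ⟨b, T, h1, fun e => by convert h2 e, h3⟩
end

section
/- Let G be a 2-connected cubic simple graph and M a perfect matching of G intersecting every 3-edge-cut of G in exactly one edge. Then the 2-regular spanning subgraph of G with edge set E(G) ∖ M contains no cycle of length 3, and every cycle of length 5 contained in E(G) ∖ M is an induced cycle of G. -/
open SimpleGraph

theorem aux_core {V : Type*} [Fintype V] [DecidableEq V]
    (G : SimpleGraph V)
    (hdel : ∀ v : V, (G.induce ({v}ᶜ : Set V)).Connected)
    (M : G.Subgraph) 
    (h3cut : ∀ S : Set V, S.Nonempty → S ≠ Set.univ →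
      {e | e ∈ G.edgeSet ∧ ∃ p q : V, e = s(p, q) ∧ p ∈ S ∧ q ∉ S}.ncard = 3 →
      ({e | e ∈ G.edgeSet ∧ ∃ p q : V, e = s(p, q) ∧ p ∈ S ∧ q ∉ S}
        ∩ M.edgeSet).ncard = 1)
    (m : V → V) (hm : ∀ v, M.Adj v (m v)) (hu : ∀ v w, M.Adj v w → w = m v)
    (S : Finset V) (hS : 2 ≤ S.card) (hodd : Odd S.card)
    (hnb : ∀ v ∈ S, ∀ w, G.Adj v w → w = m v ∨ w ∈ S) :
    S.card ≠ 3 ∧ (S.card = 5 → ∀ v ∈ S, m v ∉ S) := by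
  have hmm : ∀ v, m (m v) = v := fun v => (hu _ _ (hm v).symm).symm
  set T := S.filter (fun v => m v ∉ S) with hT
  have hTS : T ⊆ S := Finset.filter_subset _ _
  have hpar : Even (S.filter (fun v => m v ∈ S)).card := by
    have h : ∑ x ∈ S.filter (fun v => m v ∈ S), (1 : ZMod 2) = 0 := by
      refine Finset.sum_involution (fun v _ => m v) ?_ ?_ ?_ ?_
      · intros; decide
      · intro v _ _ h
        exact (hm v).ne h.symm
      · intro v hv
        simp only [Finset.mem_filter] at hv ⊢
        exact ⟨hv.2, by rw [hmm]; exact hv.1⟩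
      · intro v _; exact hmm v
    simp only [Finset.sum_const, nsmul_eq_mul, mul_one] at h
    exact (ZMod.natCast_eq_zero_iff_even).1 h
  have hsum : (S.filter (fun v => m v ∈ S)).card + T.card = S.card :=
    Finset.card_filter_add_card_filter_not _
  have hT1 : T.card ≠ 1 := by
    intro h1
    obtain ⟨t, ht⟩ := Finset.card_eq_one.1 h1
    have htT : t ∈ T := by rw [ht]; simp
    have htS := hTS htT
    have hmt : m t ∉ S := (Finset.mem_filter.1 htT).2
    obtain ⟨s, hs, hst⟩ := Finset.exists_mem_ne (by omega : 1 < S.card) t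
    have hne : m t ≠ t := fun h => (hm t).ne h.symm
    obtain ⟨p⟩ := (hdel t).preconnected ⟨s, hst⟩ ⟨m t, hne⟩
    have key : ∀ (x y : ({t}ᶜ : Set V)), (G.induce ({t}ᶜ : Set V)).Walk x y →
        (x : V) ∈ S → (y : V) ∈ S := by
      intro x y p
      induction p with
      | nil => exact id
      | @cons u v w h p ih =>
        intro hx
        apply ih
        have hadj : G.Adj (u : V) (v : V) := h
        rcases hnb _ hx _ hadj with h | h
        · by_contra hv
          have : (u : V) ∈ T := Finset.mem_filter.2 ⟨hx, h ▸ hv⟩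
          rw [ht, Finset.mem_singleton] at this
          exact u.2 this
        · exact h
    exact hmt (key _ _ p hs)
  have hT3 : T.card ≠ 3 := by
    intro h3
    have hcut : {e | e ∈ G.edgeSet ∧ ∃ p q : V, e = s(p, q) ∧ p ∈ (S : Set V) ∧ q ∉ (S : Set V)}
        = (fun v => s(v, m v)) '' (T : Set V) := by
      ext e
      constructor
      · rintro ⟨he, p, q, rfl, hp, hq⟩
        rcases hnb p hp q he with h | h
        · exact ⟨p, Finset.mem_filter.2 ⟨hp, h ▸ hq⟩, by simp [h]⟩
        · exact absurd h hq
      · rintro ⟨v, hv, rfl⟩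
        have := Finset.mem_filter.1 hv
        exact ⟨(hm v).adj_sub, v, m v, rfl, this.1, this.2⟩
    have hinj : Set.InjOn (fun v => s(v, m v)) (T : Set V) := by
      intro v hv w hw h
      simp only [Sym2.eq_iff] at h
      rcases h with h | h
      · exact h.1
      · exact absurd (h.1 ▸ hTS hv) (Finset.mem_filter.1 hw).2
    have hn : ((fun v => s(v, m v)) '' (T : Set V)).ncard = 3 := by
      rw [Set.ncard_image_of_injOn hinj, Set.ncard_coe_finset, h3]
    obtain ⟨t, ht⟩ := Finset.card_pos.1 (by omega : 0 < T.card)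
    have ht' := Finset.mem_filter.1 ht
    have h1 := h3cut (S : Set V) ⟨t, ht'.1⟩
      (fun h => ht'.2 (by have : m t ∈ (S : Set V) := by rw [h]; trivial
                          exact this))
      (by rw [hcut, hn])
    rw [hcut, Set.inter_eq_left.2, hn] at h1
    · omega
    · rintro _ ⟨v, _, rfl⟩
      exact hm v
  obtain ⟨a, ha⟩ := hpar
  obtain ⟨b, hb⟩ := hodd
  refine ⟨by omega, fun h5 v hv => ?_⟩
  have hTe : T = S := Finset.eq_of_subset_of_card_le hTS (by omega)
  rw [← hTe] at hv
  exact (Finset.mem_filter.1 hv).2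

theorem aux_card {V : Type*} [DecidableEq V] {H : SimpleGraph V} {a : V}
    (c : H.Walk a a) (hc : c.IsCycle) : c.support.toFinset.card = c.length := by
  have h1 : c.support.toFinset = c.support.tail.toFinset := by
    ext x
    simp only [List.mem_toFinset]
    refine ⟨fun h => ?_, List.mem_of_mem_tail⟩
    rcases (Walk.mem_support_iff c).1 h with h | h
    · subst h
      exact Walk.end_mem_tail_support hc.not_nil
    · exact h
  rw [h1, List.toFinset_card_of_nodup hc.support_nodup]
  simp

theorem aux_nbr {V : Type*} [Fintype V] [DecidableEq V]
    (G : SimpleGraph V) [DecidableRel G.Adj]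
    (hcubic : ∀ v : V, G.degree v = 3)
    (M : G.Subgraph) {a : V} (c : (G.deleteEdges M.edgeSet).Walk a a) (hc : c.IsCycle)
    (v : V) (hv : v ∈ c.support) (u w : V) (hu : M.Adj v u) (hw : G.Adj v w) :
    w = u ∨ s(v, w) ∈ c.edges := by
  classical
  have h2 := hc.ncard_neighborSet_toSubgraph_eq_two hv
  have hmem : ∀ x, x ∈ c.toSubgraph.neighborSet v ↔ s(v, x) ∈ c.edges := by
    intro x
    rw [Subgraph.mem_neighborSet, ← Subgraph.mem_edgeSet, Walk.mem_edges_toSubgraph]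
  have hdelE : ∀ x, s(v, x) ∈ c.edges → G.Adj v x ∧ ¬ M.Adj v x := by
    intro x hx
    have := c.edges_subset_edgeSet hx
    simpa [deleteEdges_adj] using this
  have hnot : u ∉ c.toSubgraph.neighborSet v := fun h => (hdelE u ((hmem u).1 h)).2 hu
  have hsub : insert u (c.toSubgraph.neighborSet v) ⊆ G.neighborSet v := by
    rintro x (rfl | hx)
    · exact hu.adj_sub
    · exact (hdelE x ((hmem x).1 hx)).1
  have h3 : (G.neighborSet v).ncard = 3 := by
    rw [← hcubic v, ← card_neighborSet_eq_degree, Set.ncard_eq_toFinset_card', Set.toFinset_card]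
  have heq : insert u (c.toSubgraph.neighborSet v) = G.neighborSet v := by
    apply Set.eq_of_subset_of_ncard_le hsub _ (Set.toFinite _)
    rw [Set.ncard_insert_of_notMem hnot (Set.toFinite _), h2, h3]
  have : w ∈ insert u (c.toSubgraph.neighborSet v) := by rw [heq]; exact hw
  rcases this with h | h
  · exact Or.inl h
  · exact Or.inr ((hmem w).1 h)

/-- Let `G` be a 2-connected cubic graph and `M` a perfect matching intersecting every
3-edge-cut in exactly one edge. Then the 2-regular spanning subgraph with edge set
`E(G) ∖ M` contains no 3-cycle, and every 5-cycle contained in `E(G) ∖ M` is an induced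
cycle of `G`. -/
theorem stmt13 {V : Type*} [Fintype V] [DecidableEq V]
    (G : SimpleGraph V) [DecidableRel G.Adj]
    (hcubic : ∀ v : V, G.degree v = 3)
    (hcard3 : 3 ≤ Fintype.card V)
    (hconn : G.Connected)
    (hdel : ∀ v : V, (G.induce ({v}ᶜ : Set V)).Connected)
    (M : G.Subgraph) (hM : M.IsPerfectMatching)
    (h3cut : ∀ S : Set V, S.Nonempty → S ≠ Set.univ →
      {e | e ∈ G.edgeSet ∧ ∃ p q : V, e = s(p, q) ∧ p ∈ S ∧ q ∉ S}.ncard = 3 →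
      ({e | e ∈ G.edgeSet ∧ ∃ p q : V, e = s(p, q) ∧ p ∈ S ∧ q ∉ S}
        ∩ M.edgeSet).ncard = 1) :
    (∀ (a : V) (c : (G.deleteEdges M.edgeSet).Walk a a), c.IsCycle → c.length ≠ 3) ∧
    (∀ (a : V) (c : (G.deleteEdges M.edgeSet).Walk a a), c.IsCycle → c.length = 5 →
      ∀ x y : V, x ∈ c.support → y ∈ c.support → G.Adj x y → s(x, y) ∈ c.edges) := by
  have hex : ∀ v, ∃ w, M.Adj v w ∧ ∀ y, M.Adj v y → y = w :=
    fun v => hM.1 (hM.2 v)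
  choose m hm hu using hex
  have main : ∀ (a : V) (c : (G.deleteEdges M.edgeSet).Walk a a), c.IsCycle → Odd c.length →
      c.length ≠ 3 ∧ (c.length = 5 → ∀ v ∈ c.support, m v ∉ c.support) := by
    intro a c hc hodd
    have hcard := aux_card c hc
    have h := aux_core G hdel M h3cut m hm hu c.support.toFinset
      (by have := hc.three_le_length; omega) (by rw [hcard]; exact hodd)
      (by
        intro v hv w hw
        rcases aux_nbr G hcubic M c hc v (List.mem_toFinset.1 hv) (m v) w (hm v) hw with h | h
        · exact Or.inl h
        · exact Or.inr (List.mem_toFinset.2 (c.snd_mem_support_of_mem_edges h)))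
    rw [hcard] at h
    simpa only [List.mem_toFinset] using h
  refine ⟨fun a c hc h3 => (main a c hc (by rw [h3]; decide)).1 h3, ?_⟩
  intro a c hc h5 x y hx hy hxy
  rcases aux_nbr G hcubic M c hc x hx (m x) y (hm x) hxy with h | h
  · exact absurd (h ▸ hy) ((main a c hc (by rw [h5]; decide)).2 h5 x hx)
  · exact h
end
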